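/- arXiv:2510.01876 — 2 statements merged into one kernel-verified Lean document; each statement's English description precedes it below -/
import Mathlib

section
/- Let k ≥ 2 and let w be an element of the free group F_k on k generators. The following are equivalent: (1) w is primitive; (2) there exists a positive integer N such that for all n ≥ N, the one-relator group G_n = F_k/⟨⟨w^n⟩⟩ and the group K_n = F_{k-1} * ℤ/nℤ have exactly the same finite quotients, i.e. for every finite group Q there is a surjective group homomorphism G_n → Q if and only if there is a surjective group homomorphism K_n → Q. (For finitely generated groups, having the same finite quotients is equivalent to having isomorphic profinite completions.) -/
namespace PW

/-- Inverse letter. -/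
def linv {X : Type} (y : X × Bool) : X × Bool := (y.1, !y.2)

@[simp] lemma linv_linv {X : Type} (y : X × Bool) : linv (linv y) = y := by
  simp [linv]

lemma linv_inj {X : Type} {y z : X × Bool} (h : linv y = linv z) : y = z := by
  rw [← linv_linv y, h, linv_linv]

lemma linv_ne {X : Type} (y : X × Bool) : linv y ≠ y := by
  intro h
  have := congrArg Prod.snd h
  simp [linv] at this

/-- Group element of a letter. -/
def lel {X : Type} (y : X × Bool) : FreeGroup X := FreeGroup.mk [y]

lemma lel_linv {X : Type} (y : X × Bool) : lel (linv y) = (lel y)⁻¹ := by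
  simp [lel, linv, FreeGroup.invRev]

lemma lel_true {X : Type} (x : X) : lel (x, true) = FreeGroup.of x := rfl

lemma lel_false {X : Type} (x : X) : lel (x, false) = (FreeGroup.of x)⁻¹ := by
  rw [← lel_true, ← lel_linv]; rfl

lemma letter_cases {X : Type} (y a : X × Bool) (h : y.1 = a.1) : y = a ∨ y = linv a := by
  obtain ⟨x, b⟩ := y
  obtain ⟨x', b'⟩ := a
  simp only at h
  subst h
  cases b <;> cases b' <;> simp [linv]

lemma norm_lel_le {X : Type} [DecidableEq X] (y : X × Bool) : (lel y).norm ≤ 1 := by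
  exact FreeGroup.norm_mk_le (L₁ := [y])

open Classical in
/-- `g` if `p` holds, and `1` otherwise. -/
noncomputable def ifel {X : Type} (g : FreeGroup X) (p : Prop) : FreeGroup X := if p then g else 1

lemma map_ifel {X : Type} (f : FreeGroup X →* FreeGroup X) (g : FreeGroup X) (p : Prop)
    (h : f g = g) : f (ifel g p) = ifel g p := by
  unfold ifel; split_ifs <;> simp [h]

open Classical in
/-- The Whitehead endomorphism (sign `s` selects it or its inverse). -/
noncomputable def wh {X : Type} (a : X × Bool) (g : FreeGroup X) (Y : X × Bool → Prop) :
    FreeGroup X →* FreeGroup X :=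
  FreeGroup.lift (fun x => if x = a.1 then FreeGroup.of x else
    ifel g (Y (x, true)) * FreeGroup.of x * (ifel g (Y (x, false)))⁻¹)

lemma wh_same {X : Type} (a : X × Bool) (g : FreeGroup X) (Y : X × Bool → Prop) :
    wh a g Y (lel a) = lel a := by
  obtain ⟨x, b⟩ := a
  cases b
  · simp [lel_false, wh]
  · simp [lel_true, wh]

lemma wh_other {X : Type} (a : X × Bool) (g : FreeGroup X) (Y : X × Bool → Prop) (y : X × Bool)
    (h : y.1 ≠ a.1) :
    wh a g Y (lel y) = ifel g (Y y) * lel y * (ifel g (Y (linv y)))⁻¹ := by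
  obtain ⟨x, b⟩ := y
  simp only at h
  cases b
  · simp [lel_false, wh, h, linv, mul_assoc]
  · simp [lel_true, wh, h, linv]

lemma wh_comp {X : Type} (a : X × Bool) (g g' : FreeGroup X) (Y : X × Bool → Prop)
    (hg : g = lel a ∧ g' = (lel a)⁻¹ ∨ g' = lel a ∧ g = (lel a)⁻¹) :
    (wh a g Y).comp (wh a g' Y) = MonoidHom.id _ := by
  have hgg : g' = g⁻¹ := by rcases hg with h | h <;> simp [h.1, h.2]
  have hg1 : wh a g Y g = g := by
    rcases hg with h | h
    · rw [h.1]; exact wh_same a _ Y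
    · rw [h.2, map_inv, wh_same]
  have hg2 : wh a g Y g' = g' := by rw [hgg, map_inv, hg1]
  have key : ∀ p, ifel g' p = (ifel g p)⁻¹ := by
    intro p; unfold ifel; split_ifs <;> simp [hgg]
  ext x
  by_cases hx : x = a.1
  · simp [wh, hx]
  · have h1 := wh_other a g' Y (x, true) hx
    have h2 := wh_other a g Y (x, true) hx
    rw [lel_true] at h1 h2
    simp only [MonoidHom.comp_apply, MonoidHom.id_apply]
    rw [h1, map_mul, map_mul, map_inv, map_ifel _ _ _ hg2, map_ifel _ _ _ hg2, h2, key, key]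
    group

/-- The Whitehead automorphism. -/
noncomputable def whE {X : Type} (a : X × Bool) (Y : X × Bool → Prop) :
    FreeGroup X ≃* FreeGroup X :=
  MonoidHom.toMulEquiv (wh a (lel a) Y) (wh a (lel a)⁻¹ Y)
    (wh_comp a _ _ Y (Or.inr ⟨rfl, rfl⟩)) (wh_comp a _ _ Y (Or.inl ⟨rfl, rfl⟩))

/-- Product of the first `n` letters of `y`. -/
noncomputable def wprod {X : Type} (y : ℕ → X × Bool) : ℕ → FreeGroup X
  | 0 => 1
  | n + 1 => wprod y n * lel (y n)

lemma wprod_shift {X : Type} (y : ℕ → X × Bool) (n : ℕ) :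
    lel (y 0) * wprod (fun i => y (i + 1)) n = wprod y n * lel (y n) := by
  induction n with
  | zero => simp [wprod]
  | succ n ih => rw [wprod, ← mul_assoc, ih]; rfl

theorem whitehead_reduce {X : Type} [DecidableEq X] (L : ℕ) (hL : 0 < L) (y : ℕ → X × Bool)
    (hper : Function.Periodic y L) (a : X × Bool) (Y : X × Bool → Prop)
    (ha : ¬ Y a) (ha' : ¬ Y (linv a))
    (hgap : ∀ i, linv (y i) ≠ a → y (i + 1) ≠ a → (Y (linv (y i)) ↔ Y (y (i + 1))))
    (hex : ∃ i, (linv (y i) = a ∧ Y (y (i + 1))) ∨ (y (i + 1) = a ∧ Y (linv (y i)))) :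
    ∃ α : FreeGroup X ≃* FreeGroup X, (α (wprod y L)).norm < L := by
  set T : ℕ → Prop := fun i => Y (linv (y i)) ∨ Y (y (i + 1)) with hT
  have hTd : ∀ i, Decidable (T i) := fun i => Classical.dec _
  set S : ℕ → Prop := fun i => (y (i + 1) = linv a ∧ Y (y (i + 2))) ∨
    (y (i + 1) = a ∧ Y (linv (y i))) with hS
  have hSper : Function.Periodic S L := by
    intro i
    simp only [hS]
    rw [show i + L + 1 = (i + 1) + L by ring, show i + L + 2 = (i + 2) + L by ring, hper, hper,
      hper]
  have hTper : Function.Periodic T L := by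
    intro i
    simp only [hT]
    rw [show i + L + 1 = (i + 1) + L by ring, hper, hper]
  have hSex : ∃ i, i < L ∧ S i := by
    obtain ⟨i, hi⟩ := hex
    rcases hi with hi | hi
    · refine ⟨(i + L - 1) % L, Nat.mod_lt _ hL, ?_⟩
      rw [hSper.map_mod_nat]
      left
      rw [show i + L - 1 + 1 = i + L by omega, show i + L - 1 + 2 = i + 1 + L by omega, hper, hper]
      exact ⟨by rw [← hi.1, linv_linv], hi.2⟩
    · refine ⟨i % L, Nat.mod_lt _ hL, ?_⟩
      rw [hSper.map_mod_nat]
      exact Or.inr hi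
  -- one letter
  have step : ∀ i, ∃ q : FreeGroup X, q.norm ≤ 1 ∧ (S i → q.norm = 0) ∧
      whE a Y (lel (y (i + 1))) = ifel (lel a) (T i) * q * (ifel (lel a) (T (i + 1)))⁻¹ := by
    intro i
    by_cases h1 : (y (i + 1)).1 = a.1
    · rcases letter_cases _ _ h1 with h | h
      · have hT1 : ¬ T (i + 1) := by
          simp only [hT, h]
          rintro (h2 | h2)
          · exact ha' h2
          · have h3 := hgap (i + 1) (by rw [h]; exact linv_ne a)
              (by intro h4; rw [h4] at h2; exact ha h2)
            rw [h] at h3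
            exact ha' (h3.2 h2)
        refine ⟨if T i then 1 else lel a, ?_, ?_, ?_⟩
        · split_ifs
          · simp
          · exact norm_lel_le a
        · intro hs
          have : T i := by
            rcases hs with hs | hs
            · exact absurd (hs.1.symm.trans h) (linv_ne a)
            · exact Or.inl hs.2
          simp [this]
        · have : whE a Y (lel (y (i + 1))) = lel a := by rw [h]; exact wh_same a _ Y
          rw [this]
          unfold ifel
          simp only [hT1, if_false]
          split_ifs <;> simp
      · have hT1 : ¬ T i := by
          simp only [hT, h]
          rintro (h2 | h2)
          · have h3 := hgap i (by intro h4; rw [h4] at h2; exact ha h2)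
              (by rw [h]; exact linv_ne a)
            rw [h] at h3
            exact ha' (h3.1 h2)
          · exact ha' h2
        refine ⟨if T (i + 1) then 1 else (lel a)⁻¹, ?_, ?_, ?_⟩
        · split_ifs
          · simp
          · rw [FreeGroup.norm_inv_eq]; exact norm_lel_le a
        · intro hs
          have : T (i + 1) := by
            rcases hs with hs | hs
            · exact Or.inr hs.2
            · exact absurd (h.symm.trans hs.1) (linv_ne a)
          simp [this]
        · have : whE a Y (lel (y (i + 1))) = (lel a)⁻¹ := by
            rw [h, lel_linv, map_inv]; congr 1; exact wh_same a _ Y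
          rw [this]
          unfold ifel
          simp only [hT1, if_false]
          split_ifs <;> simp
    · have hna : y (i + 1) ≠ a := fun h => h1 (by rw [h])
      have hna' : linv (y (i + 1)) ≠ a := fun h => h1 (by rw [← h]; rfl)
      have e1 : T i ↔ Y (y (i + 1)) := by
        simp only [hT]
        constructor
        · rintro (h | h)
          · exact (hgap i (by intro h4; rw [h4] at h; exact ha h) hna).1 h
          · exact h
        · exact Or.inr
      have e2 : T (i + 1) ↔ Y (linv (y (i + 1))) := by
        simp only [hT]
        constructor
        · rintro (h | h)
          · exact h
          · exact (hgap (i + 1) hna' (by intro h4; rw [h4] at h; exact ha h)).2 h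
        · exact Or.inl
      refine ⟨lel (y (i + 1)), norm_lel_le _, ?_, ?_⟩
      · rintro (h | h)
        · exact absurd (by rw [h.1]; rfl) h1
        · exact absurd h.1 hna
      · rw [propext e1, propext e2]
        exact wh_other a _ Y _ h1
  have main : ∀ j, ∃ q : FreeGroup X, q.norm ≤ j ∧ ((∃ i, i < j ∧ S i) → q.norm < j) ∧
      whE a Y (wprod (fun i => y (i + 1)) j) =
        ifel (lel a) (T 0) * q * (ifel (lel a) (T j))⁻¹ := by
    intro j
    induction j with
    | zero => exact ⟨1, by simp, by rintro ⟨i, hi, _⟩; omega, by simp [wprod]⟩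
    | succ j ih =>
      obtain ⟨q, h1, h2, h3⟩ := ih
      obtain ⟨r, k1, k2, k3⟩ := step j
      have hn := FreeGroup.norm_mul_le q r
      refine ⟨q * r, by omega, ?_, ?_⟩
      · rintro ⟨i, hi, hs⟩
        by_cases hij : i = j
        · subst hij
          have := k2 hs
          omega
        · have := h2 ⟨i, by omega, hs⟩
          omega
      · rw [wprod, map_mul, h3, k3]
        group
  obtain ⟨q, -, h2, h3⟩ := main L
  have hTL : T L = T 0 := by simpa using hTper 0
  rw [hTL] at h3
  refine ⟨(whE a Y).trans (MulAut.conj ((whE a Y (lel (y 0)) * ifel (lel a) (T 0))⁻¹)), ?_⟩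
  have hsh := wprod_shift y L
  have hyL : y L = y 0 := by simpa using hper 0
  rw [hyL] at hsh
  have hw : wprod y L = lel (y 0) * wprod (fun i => y (i + 1)) L * (lel (y 0))⁻¹ := by
    rw [hsh]; group
  have : ((whE a Y).trans (MulAut.conj ((whE a Y (lel (y 0)) * ifel (lel a) (T 0))⁻¹)))
      (wprod y L) = q := by
    rw [hw, MulEquiv.trans_apply, MulAut.conj_apply, map_mul, map_mul, map_inv, h3]
    group
  rw [this]
  exact h2 hSex

end PW

namespace PW

lemma fix_wprod {X : Type} (f : FreeGroup X →* FreeGroup X) (x : X)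
    (hf : ∀ x', x' ≠ x → f (FreeGroup.of x') = FreeGroup.of x') (y : ℕ → X × Bool) (n : ℕ)
    (h : ∀ i, i < n → (y i).1 ≠ x) : f (wprod y n) = wprod y n := by
  induction n with
  | zero => simp [wprod]
  | succ n ih =>
    rw [wprod, map_mul, ih (fun i hi => h i (by omega))]
    congr 1
    have h1 := hf _ (h n (by omega))
    rcases hy : y n with ⟨x', b⟩
    rw [hy] at h1
    cases b
    · rw [lel_false, map_inv, h1]
    · rw [lel_true, h1]

lemma wprod_succ' {X : Type} (y : ℕ → X × Bool) (n : ℕ) :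
    wprod y (n + 1) = lel (y 0) * wprod (fun i => y (i + 1)) n := by
  rw [wprod_shift]; rfl

theorem primitive_of_once {X : Type} [DecidableEq X] (L : ℕ) (hL : 0 < L) (y : ℕ → X × Bool)
    (h : ∀ i, 0 < i → i < L → (y i).1 ≠ (y 0).1) :
    ∃ (e : FreeGroup X ≃* FreeGroup X) (x : X), e (FreeGroup.of x) = wprod y L := by
  obtain ⟨n, rfl⟩ : ∃ n, L = n + 1 := ⟨L - 1, by omega⟩
  rw [wprod_succ']
  rcases hy : y 0 with ⟨x, b⟩
  set r := wprod (fun i => y (i + 1)) n with hr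
  have hfix : ∀ f : FreeGroup X →* FreeGroup X,
      (∀ x', x' ≠ x → f (FreeGroup.of x') = FreeGroup.of x') → f r = r := by
    intro f hf
    refine fix_wprod f x hf _ n ?_
    intro i hi
    have := h (i + 1) (by omega) (by omega)
    rw [hy] at this
    exact this
  have mk : ∀ u v : FreeGroup X, ∃ f g : FreeGroup X →* FreeGroup X,
      (∀ x', x' ≠ x → f (FreeGroup.of x') = FreeGroup.of x') ∧ f (FreeGroup.of x) = u ∧
      (∀ x', x' ≠ x → g (FreeGroup.of x') = FreeGroup.of x') ∧ g (FreeGroup.of x) = v := by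
    intro u v
    refine ⟨FreeGroup.lift (fun x' => if x' = x then u else FreeGroup.of x'),
      FreeGroup.lift (fun x' => if x' = x then v else FreeGroup.of x'), ?_, ?_, ?_, ?_⟩
    · intro x' hx'; simp [hx']
    · simp
    · intro x' hx'; simp [hx']
    · simp
  have fin : ∀ u v : FreeGroup X, (∀ f : FreeGroup X →* FreeGroup X,
      (∀ x', x' ≠ x → f (FreeGroup.of x') = FreeGroup.of x') → f (FreeGroup.of x) = u →
        f v = FreeGroup.of x) → (∀ f : FreeGroup X →* FreeGroup X,
      (∀ x', x' ≠ x → f (FreeGroup.of x') = FreeGroup.of x') → f (FreeGroup.of x) = v →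
        f u = FreeGroup.of x) → ∃ (e : FreeGroup X ≃* FreeGroup X) (x : X),
        e (FreeGroup.of x) = u := by
    intro u v h1 h2
    obtain ⟨f, g, hf, hfu, hg, hgv⟩ := mk u v
    refine ⟨MonoidHom.toMulEquiv f g ?_ ?_, x, hfu⟩
    · ext x'
      by_cases hx : x' = x
      · subst hx; simp [hfu, h2 g hg hgv]
      · simp [hf _ hx, hg _ hx]
    · ext x'
      by_cases hx : x' = x
      · subst hx; simp [hgv, h1 f hf hfu]
      · simp [hf _ hx, hg _ hx]
  cases b
  · rw [lel_false]
    refine fin _ (r * (FreeGroup.of x)⁻¹) ?_ ?_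
    · intro f hf hfu
      rw [map_mul, map_inv, hfix f hf, hfu]; group
    · intro f hf hfu
      rw [map_mul, map_inv, hfix f hf, hfu]; group
  · rw [lel_true]
    refine fin _ (FreeGroup.of x * r⁻¹) ?_ ?_
    · intro f hf hfu
      rw [map_mul, map_inv, hfix f hf, hfu]; group
    · intro f hf hfu
      rw [map_mul, hfix f hf, hfu]; group

theorem root_case {X K : Type} [DecidableEq X] (L : ℕ) (hL : 0 < L) (y : ℕ → X × Bool)
    (hper : Function.Periodic y L) (hcyc : ∀ i, linv (y i) ≠ y (i + 1)) (κ : X × Bool → K)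
    (hgap0 : ∀ i, i + 1 < L → κ (linv (y i)) = κ (y (i + 1)))
    (h0 : κ (linv (y (L - 1))) ≠ κ (y 0)) :
    (∃ α : FreeGroup X ≃* FreeGroup X, (α (wprod y L)).norm < L) ∨
    ∃ (e : FreeGroup X ≃* FreeGroup X) (x : X), e (FreeGroup.of x) = wprod y L := by
  -- either an ordinary gap or gap zero
  have hgap : ∀ i, κ (linv (y i)) = κ (y (i + 1)) ∨ (y (i + 1) = y 0 ∧ y i = y (L - 1)) := by
    intro i
    have hm := Nat.mod_lt i hL
    have e1 : y i = y (i % L) := (hper.map_mod_nat i).symm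
    have e2 : y (i + 1) = y (i % L + 1) := by
      rw [← hper.map_mod_nat (i + 1), ← hper.map_mod_nat (i % L + 1)]
      congr 1
      simp [Nat.add_mod]
    by_cases h : i % L + 1 < L
    · left; rw [e1, e2]; exact hgap0 _ h
    · right
      rw [e1, e2, show i % L + 1 = 0 + L by omega, hper, show i % L = L - 1 by omega]
      exact ⟨rfl, rfl⟩
  by_cases hb : κ (linv (y 0)) = κ (y 0)
  · left
    refine whitehead_reduce L hL y hper (y 0) (fun z => κ z ≠ κ (y 0)) (by simp) (by simp [hb]) ?_ ?_
    · intro i h1 h2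
      rcases hgap i with h | h
      · rw [h]
      · exact absurd h.1 h2
    · refine ⟨L - 1, Or.inr ⟨?_, h0⟩⟩
      rw [show L - 1 + 1 = 0 + L by omega, hper]
  · by_cases hex : ∃ i, (linv (y i) = y 0 ∧ (κ (y (i + 1)) = κ (y 0) ∧ y (i + 1) ≠ y 0)) ∨
      (y (i + 1) = y 0 ∧ (κ (linv (y i)) = κ (y 0) ∧ linv (y i) ≠ y 0))
    · left
      refine whitehead_reduce L hL y hper (y 0) (fun z => κ z = κ (y 0) ∧ z ≠ y 0)
        (by simp) (by simp [hb]) ?_ hex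
      intro i h1 h2
      rcases hgap i with h | h
      · simp [h, h1, h2]
      · exact absurd h.1 h2
    · right
      push Not at hex
      apply primitive_of_once L hL y
      intro i hi hiL h1
      rcases letter_cases _ _ h1 with h | h
      · -- gap before
        obtain ⟨j, rfl⟩ : ∃ j, i = j + 1 := ⟨i - 1, by omega⟩
        have hk := hgap0 j hiL
        rw [h] at hk
        have := (hex j).2 h hk
        exact hcyc j (by rw [this, h])
      · have hl : linv (y i) = y 0 := by rw [h, linv_linv]
        by_cases hi2 : i + 1 < L
        · have hk := hgap0 i hi2
          rw [hl] at hk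
          have := (hex i).1 hl hk.symm
          exact hcyc i (by rw [this, hl])
        · have : i = L - 1 := by omega
          subst this
          exact h0 (by rw [hl])

theorem branch_case {X K : Type} [DecidableEq X] (L : ℕ) (hL : 0 < L) (y : ℕ → X × Bool)
    (hper : Function.Periodic y L) (hcyc : ∀ i, linv (y i) ≠ y (i + 1)) (κ : X × Bool → K)
    (a : X × Bool)
    (hgap : ∀ i, linv (y i) ≠ a → y (i + 1) ≠ a → κ (linv (y i)) = κ (y (i + 1)))
    (hne : ∃ b c, b ≠ a ∧ c ≠ a ∧ κ b ≠ κ c) (hused : ∀ x, ∃ i, (y i).1 = x) :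
    ∃ α : FreeGroup X ≃* FreeGroup X, (α (wprod y L)).norm < L := by
  set Y : X × Bool → Prop := fun z => z ≠ a ∧ κ z ≠ κ (linv a) with hY
  have hYne : ∃ b, Y b := by
    obtain ⟨b, c, hb, hc, hbc⟩ := hne
    by_cases h : κ b = κ (linv a)
    · exact ⟨c, hc, fun h' => hbc (h.trans h'.symm)⟩
    · exact ⟨b, hb, h⟩
  by_cases hex : ∃ i, (linv (y i) = a ∧ Y (y (i + 1))) ∨ (y (i + 1) = a ∧ Y (linv (y i)))
  · refine whitehead_reduce L hL y hper a Y (by simp [hY]) (by simp [hY]) ?_ hex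
    intro i h1 h2
    simp [hY, h1, h2, hgap i h1 h2]
  · push Not at hex
    have hclosed : ∀ i, Y (linv (y i)) ↔ Y (y (i + 1)) := by
      intro i
      by_cases h1 : linv (y i) = a
      · have := (hex i).1 h1
        simp only [this, iff_false, h1]
        simp [hY]
      · by_cases h2 : y (i + 1) = a
        · have := (hex i).2 h2
          simp only [this, false_iff, h2]
          simp [hY]
        · simp [hY, h1, h2, hgap i h1 h2]
    by_cases hinv : ∀ z, Y z → Y (linv z)
    · exfalso
      have hinv' : ∀ z, Y (linv z) → Y z := fun z hz => by simpa using hinv _ hz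
      obtain ⟨b, hb⟩ := hYne
      obtain ⟨i, hi⟩ := hused b.1
      have hyi : Y (y i) := by
        rcases letter_cases _ _ hi with h | h
        · rw [h]; exact hb
        · rw [h]; exact hinv _ hb
      have hall : ∀ j, Y (y (i + j)) := by
        intro j
        induction j with
        | zero => exact hyi
        | succ j ih => exact (hclosed (i + j)).1 (hinv _ ih)
      obtain ⟨m, hm⟩ := hused a.1
      have hmi : Y (y m) := by
        have h1 := hall (m + i * L - i)
        have : i ≤ i * L := Nat.le_mul_of_pos_right _ hL
        rw [show i + (m + i * L - i) = m + i * L by omega] at h1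
        have h2 := hper.nat_mul i m
        simp only [Nat.cast_id] at h2
        rwa [h2] at h1
      rcases letter_cases _ _ hm with h | h
      · rw [h] at hmi; exact hmi.1 rfl
      · rw [h] at hmi; exact hmi.2 rfl
    · push Not at hinv
      obtain ⟨z, hz, hz'⟩ := hinv
      refine whitehead_reduce L hL y hper z (fun u => Y u ∧ u ≠ z) (by simp) (by simp [hz']) ?_ ?_
      · intro i h1 h2
        simp [h1, h2, hclosed i]
      · obtain ⟨i, hi⟩ := hused z.1
        rcases letter_cases _ _ hi with h | h
        · have e : y (i + L - 1 + 1) = z := by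
            rw [show i + L - 1 + 1 = i + L by omega, hper, h]
          refine ⟨i + L - 1, Or.inr ⟨e, ?_, ?_⟩⟩
          · rw [hclosed, e]; exact hz
          · rw [← e]; exact hcyc _
        · have e : linv (y i) = z := by rw [h, linv_linv]
          refine ⟨i, Or.inl ⟨e, ?_, ?_⟩⟩
          · rw [← hclosed, e]; exact hz
          · rw [← e]; exact fun h => hcyc _ h.symm

end PW

namespace PW

variable {X : Type} [DecidableEq X]

/-- First letter of the reduced word. -/
def hd (g : FreeGroup X) : Option (X × Bool) := g.toWord.head?

lemma hd_one : hd (1 : FreeGroup X) = none := by simp [hd]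

lemma hd_eq_none {g : FreeGroup X} (h : hd g = none) : g = 1 := by
  simpa [hd] using h

lemma rel_iff (a b : X × Bool) : (a.1 = b.1 → a.2 = b.2) ↔ linv a ≠ b := by
  obtain ⟨x, s⟩ := a
  obtain ⟨x', s'⟩ := b
  cases s <;> cases s' <;> simp [linv, Prod.ext_iff]

lemma isReduced_append {l₁ l₂ : List (X × Bool)} (h₁ : FreeGroup.IsReduced l₁)
    (h₂ : FreeGroup.IsReduced l₂)
    (h : ∀ a ∈ l₁.getLast?, ∀ b ∈ l₂.head?, linv a ≠ b) : FreeGroup.IsReduced (l₁ ++ l₂) := by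
  unfold FreeGroup.IsReduced at *
  rw [List.isChain_append]
  exact ⟨h₁, h₂, fun a ha b hb => (rel_iff a b).2 (h a ha b hb)⟩

lemma invRev_eq (l : List (X × Bool)) : FreeGroup.invRev l = (l.map linv).reverse := rfl

lemma hd_inv (g : FreeGroup X) : hd g⁻¹ = g.toWord.getLast?.map linv := by
  rw [hd, FreeGroup.toWord_inv, invRev_eq, List.head?_reverse, List.getLast?_map]

lemma toWord_mul_of {u g : FreeGroup X} (z : X × Bool) (hz : hd g = some z)
    (h : hd u⁻¹ ≠ some z) : (u * g).toWord = u.toWord ++ g.toWord := by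
  rw [FreeGroup.toWord_mul]
  apply FreeGroup.IsReduced.reduce_eq
  apply isReduced_append FreeGroup.isReduced_toWord FreeGroup.isReduced_toWord
  intro a ha b hb hab
  apply h
  rw [hd_inv]
  rw [hd] at hz
  rw [hz] at hb
  simp only [Option.mem_def] at ha hb
  rw [ha]
  simp only [Option.map_some]
  rw [hab, hb]

lemma toWord_lel (z : X × Bool) : (lel z).toWord = [z] := by
  simp [lel]

lemma hd_lel (z : X × Bool) : hd (lel z) = some z := by simp [hd, toWord_lel]

/-- Splitting off the first letter. -/
lemma hd_split {g : FreeGroup X} {z : X × Bool} (hz : hd g = some z) :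
    ∃ g', g = lel z * g' ∧ hd g' ≠ some (linv z) := by
  obtain ⟨l, hl⟩ : ∃ l, g.toWord = z :: l := by
    unfold hd at hz
    cases h : g.toWord with
    | nil => simp [h] at hz
    | cons b l => rw [h] at hz; simp at hz; exact ⟨l, by rw [hz]⟩
  have hred : FreeGroup.IsReduced (z :: l) := hl ▸ FreeGroup.isReduced_toWord
  refine ⟨FreeGroup.mk l, ?_, ?_⟩
  · rw [lel, FreeGroup.mul_mk, ← FreeGroup.mk_toWord (x := g), hl]; rfl
  · have hl2 : FreeGroup.IsReduced l := List.IsChain.tail hred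
    rw [hd, FreeGroup.toWord_mk, hl2.reduce_eq]
    cases l with
    | nil => simp
    | cons b l =>
      rw [FreeGroup.isReduced_cons_cons] at hred
      have := (rel_iff _ _).1 hred.1
      simpa using this.symm

lemma wprod_add (y : ℕ → X × Bool) (m n : ℕ) :
    wprod y (m + n) = wprod y m * wprod (fun i => y (m + i)) n := by
  induction n with
  | zero => simp [wprod]
  | succ n ih => rw [← add_assoc, wprod, ih, wprod, mul_assoc]

lemma wprod_eq_mk (y : ℕ → X × Bool) (n : ℕ) :
    wprod y n = FreeGroup.mk ((List.range n).map y) := by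
  induction n with
  | zero => simp [wprod]; rfl
  | succ n ih => rw [wprod, ih, List.range_succ, List.map_append, lel, FreeGroup.mul_mk]; rfl

lemma toWord_wprod (y : ℕ → X × Bool) (hcyc : ∀ i, linv (y i) ≠ y (i + 1)) (n : ℕ) :
    (wprod y n).toWord = (List.range n).map y := by
  rw [wprod_eq_mk, FreeGroup.toWord_mk]
  apply FreeGroup.IsReduced.reduce_eq
  unfold FreeGroup.IsReduced
  rw [List.isChain_iff_getElem]
  intro i hi
  rw [rel_iff]
  simpa using hcyc i

lemma hd_wprod (y : ℕ → X × Bool) (hcyc : ∀ i, linv (y i) ≠ y (i + 1)) (n : ℕ) (hn : 0 < n) :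
    hd (wprod y n) = some (y 0) := by
  obtain ⟨m, rfl⟩ : ∃ m, n = m + 1 := ⟨n - 1, by omega⟩
  rw [hd, toWord_wprod y hcyc, List.range_succ_eq_map]; simp

lemma hd_wprod_inv (y : ℕ → X × Bool) (hcyc : ∀ i, linv (y i) ≠ y (i + 1)) (n : ℕ) :
    hd (wprod y (n + 1))⁻¹ = some (linv (y n)) := by
  rw [hd_inv, toWord_wprod y hcyc, List.range_succ]; simp

lemma wprod_pow (y : ℕ → X × Bool) (L : ℕ) (hper : Function.Periodic y L) (n : ℕ) :
    wprod y L ^ n = wprod y (n * L) := by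
  induction n with
  | zero => simp [wprod]
  | succ n ih =>
    rw [pow_succ, ih, Nat.succ_mul, wprod_add]
    congr 2
    funext i
    have h2 := hper.nat_mul n i
    simp only [Nat.cast_id] at h2
    rw [add_comm, h2]

/-- Heads of the points of a line. -/
lemma hd_line_pos (y : ℕ → X × Bool) (L : ℕ) (hper : Function.Periodic y L)
    (hcyc : ∀ i, linv (y i) ≠ y (i + 1)) (i n : ℕ) (hn : i + 1 < n * L) :
    hd ((wprod y (i + 1))⁻¹ * wprod y L ^ (n : ℤ)) = some (y (i + 1)) := by
  rw [zpow_natCast, wprod_pow y L hper, show n * L = (i + 1) + (n * L - (i + 1)) by omega,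
    wprod_add y (i + 1) (n * L - (i + 1)), inv_mul_cancel_left, hd_wprod]
  · intro j; exact hcyc (i + 1 + j)
  · omega

lemma hd_line_mid (y : ℕ → X × Bool) (L : ℕ) (hper : Function.Periodic y L)
    (hcyc : ∀ i, linv (y i) ≠ y (i + 1)) (i n : ℕ) (hn : n * L < i + 1) :
    hd ((wprod y (i + 1))⁻¹ * wprod y L ^ (n : ℤ)) = some (linv (y i)) := by
  rw [zpow_natCast, wprod_pow y L hper, show i + 1 = n * L + ((i - n * L) + 1) by omega,
    wprod_add, mul_inv_rev, inv_mul_cancel_right, hd_wprod_inv]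
  · congr 3; omega
  · intro j; exact hcyc (n * L + j)

lemma hd_line_neg (y : ℕ → X × Bool) (L : ℕ) (hper : Function.Periodic y L)
    (hcyc : ∀ i, linv (y i) ≠ y (i + 1)) (i n : ℕ) :
    hd ((wprod y (i + 1))⁻¹ * wprod y L ^ (-(n : ℤ))) = some (linv (y i)) := by
  rw [zpow_neg, zpow_natCast, wprod_pow y L hper, ← mul_inv_rev]
  have : wprod y (n * L) * wprod y (i + 1) = wprod y (n * L + i + 1) := by
    rw [add_assoc, wprod_add y (n * L) (i + 1)]
    congr 2
    funext j
    have h2 := hper.nat_mul n j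
    simp only [Nat.cast_id] at h2
    rw [add_comm, h2]
  rw [this, hd_wprod_inv y hcyc]
  have h2 := hper.nat_mul n i
  simp only [Nat.cast_id] at h2
  rw [add_comm, h2]

lemma hd_line (y : ℕ → X × Bool) (L : ℕ) (hper : Function.Periodic y L)
    (hcyc : ∀ i, linv (y i) ≠ y (i + 1)) (i : ℕ) (n : ℤ) (g : FreeGroup X)
    (hg : g = (wprod y (i + 1))⁻¹ * wprod y L ^ n) (hg1 : g ≠ 1) :
    hd g = some (y (i + 1)) ∨ hd g = some (linv (y i)) := by
  obtain ⟨m, rfl | rfl⟩ := n.eq_nat_or_neg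
  · rcases lt_trichotomy (m * L) (i + 1) with h | h | h
    · right; rw [hg]; exact hd_line_mid y L hper hcyc i m h
    · exfalso
      apply hg1
      rw [hg, zpow_natCast, wprod_pow y L hper, h, inv_mul_cancel]
    · left; rw [hg]; exact hd_line_pos y L hper hcyc i m h
  · right; rw [hg]; exact hd_line_neg y L hper hcyc i m

/-- A cyclically reduced word as a periodic sequence. -/
lemma exists_seq (w : FreeGroup X) (hw : w ≠ 1) (hc : FreeGroup.IsCyclicallyReduced w.toWord) :
    ∃ y : ℕ → X × Bool, Function.Periodic y w.norm ∧ (∀ i, linv (y i) ≠ y (i + 1)) ∧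
      wprod y w.norm = w ∧ ∀ z ∈ w.toWord, ∃ i, y i = z := by
  have hL : 0 < w.toWord.length := by
    rw [List.length_pos_iff]
    simpa using hw
  have hn : w.norm = w.toWord.length := rfl
  refine ⟨fun i => w.toWord[i % w.toWord.length]'(Nat.mod_lt _ hL), ?_, ?_, ?_, ?_⟩
  · intro i
    simp [hn]
  · intro i
    have hm := Nat.mod_lt i hL
    rw [← rel_iff]
    by_cases h : i % w.toWord.length + 1 < w.toWord.length
    · have h1 := hc.1
      unfold FreeGroup.IsReduced at h1
      rw [List.isChain_iff_getElem] at h1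
      have h2 := h1 _ h
      have e : (i + 1) % w.toWord.length = i % w.toWord.length + 1 := by
        rw [Nat.add_mod_eq_ite, Nat.mod_eq_of_lt (a := 1) (by omega), if_neg (by omega)]
      simp only [e]
      exact h2
    · have e : (i + 1) % w.toWord.length = 0 := by
        have : i % w.toWord.length = w.toWord.length - 1 := by omega
        rw [Nat.add_mod, this]
        rcases Nat.lt_or_ge 1 w.toWord.length with h1 | h1
        · rw [Nat.mod_eq_of_lt h1, Nat.sub_add_cancel hL, Nat.mod_self]
        · rw [show w.toWord.length = 1 by omega]
      have e' : i % w.toWord.length = w.toWord.length - 1 := by omega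
      simp only [e, e']
      apply hc.2
      · rw [List.getLast?_eq_getElem?]; simp
      · rw [List.head?_eq_getElem?]; simp [hL]
  · rw [wprod_eq_mk]
    refine Eq.trans ?_ FreeGroup.mk_toWord
    congr 1
    apply List.ext_getElem
    · simp [hn]
    · intro i h1 h2
      have : i % w.toWord.length = i := Nat.mod_eq_of_lt (by simpa using h2)
      simp [this]
  · intro z hz
    obtain ⟨i, hi, rfl⟩ := List.getElem_of_mem hz
    exact ⟨i, by simp [Nat.mod_eq_of_lt hi]⟩

end PW

namespace PW

variable {X : Type} [DecidableEq X]

lemma hd_ne_one {g : FreeGroup X} {z : X × Bool} (h : hd g = some z) : g ≠ 1 := by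
  rintro rfl
  rw [hd_one] at h
  cases h

lemma toWord_mul_lel {u : FreeGroup X} {z : X × Bool} (h : hd u⁻¹ ≠ some z) :
    (u * lel z).toWord = u.toWord ++ [z] := by
  rw [toWord_mul_of z (hd_lel z) h, toWord_lel]

lemma norm_mul_lel {u : FreeGroup X} {z : X × Bool} (h : hd u⁻¹ ≠ some z) :
    (u * lel z).norm = u.norm + 1 := by
  simp [FreeGroup.norm, toWord_mul_lel h]

lemma hd_mul_lel_inv {u : FreeGroup X} {z : X × Bool} (h : hd u⁻¹ ≠ some z) :
    hd (u * lel z)⁻¹ = some (linv z) := by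
  rw [hd_inv, toWord_mul_lel h]; simp

lemma norm_split {g : FreeGroup X} {z : X × Bool} (h : hd g ≠ some (linv z)) :
    (lel z * g).norm = g.norm + 1 := by
  cases hg : hd g with
  | none =>
    rw [hd_eq_none hg]
    simp [FreeGroup.norm, toWord_lel]
  | some b =>
    have := toWord_mul_of (u := lel z) b hg (by
      rw [← lel_linv, hd_lel, ← hg]; exact h.symm)
    rw [FreeGroup.norm, this, toWord_lel]
    simp [FreeGroup.norm]

/-- Cones far out are monochromatic. -/
lemma far_const {K : Type} (ψ : FreeGroup X → K) (R : ℕ)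
    (hR : ∀ (b : X × Bool) (r : FreeGroup X), R ≤ r.norm → ψ (r * lel b) = ψ r) :
    ∀ (n : ℕ) (u g : FreeGroup X), g.norm = n → R ≤ u.norm → (∀ z, hd g = some z → hd u⁻¹ ≠ some z) →
      ψ (u * g) = ψ u := by
  intro n
  induction n with
  | zero =>
    intro u g hg _ _
    rw [FreeGroup.norm_eq_zero] at hg
    rw [hg, mul_one]
  | succ n ih =>
    intro u g hg hu hz
    cases hh : hd g with
    | none =>
      rw [hd_eq_none hh, mul_one]
    | some z =>
      obtain ⟨g', rfl, hg'⟩ := hd_split hh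
      have h1 := hz z hh
      have h2 := norm_split hg'
      rw [← mul_assoc, ih (u * lel z) g' (by omega) (by rw [norm_mul_lel h1]; omega), hR z u hu]
      intro z' hz' h3
      rw [hd_mul_lel_inv h1] at h3
      rw [h3] at hg'
      exact hg' hz'

lemma exists_R [Finite X] {K : Type} (ψ : FreeGroup X → K)
    (hfin : ∀ g, {r | ψ (r * g) ≠ ψ r}.Finite) :
    ∃ R : ℕ, ∀ (b : X × Bool) (r : FreeGroup X), R ≤ r.norm → ψ (r * lel b) = ψ r := by
  have h : (⋃ b : X × Bool, {r | ψ (r * lel b) ≠ ψ r}).Finite :=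
    Set.finite_iUnion (fun b => hfin (lel b))
  obtain ⟨R, hR⟩ := (h.image FreeGroup.norm).bddAbove
  refine ⟨R + 1, fun b r hr => ?_⟩
  by_contra hne
  have := hR ⟨r, Set.mem_iUnion.2 ⟨b, hne⟩, rfl⟩
  omega

/-- The cone `(u, z)` is monochromatic up to finitely many elements, with colour `κ`. -/
def ColC {K : Type} (ψ : FreeGroup X → K) (u : FreeGroup X) (z : X × Bool) (κ : K) : Prop :=
  {g | hd g = some z ∧ ψ (u * g) ≠ κ}.Finite

lemma dichotomy [Finite X] {K : Type} (ψ : FreeGroup X → K)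
    (hfin : ∀ g, {r | ψ (r * g) ≠ ψ r}.Finite) :
    (∃ κ : X × Bool → K, ∀ z, ColC ψ 1 z (κ z)) ∨
    (∃ (v : FreeGroup X) (a : X × Bool) (κ : X × Bool → K), hd v⁻¹ = some a ∧
      (∀ z, z ≠ a → ColC ψ v z (κ z)) ∧ ∃ b c, b ≠ a ∧ c ≠ a ∧ κ b ≠ κ c) := by
  classical
  obtain ⟨R, hR⟩ := exists_R ψ hfin
  have hfar : ∀ u z, hd u⁻¹ ≠ some z → R ≤ u.norm → ColC ψ u z (ψ u) := by
    intro u z huz hu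
    unfold ColC
    convert Set.finite_empty
    rw [Set.eq_empty_iff_forall_notMem]
    rintro g ⟨hg, hne⟩
    apply hne
    apply far_const ψ R hR _ u g rfl hu
    intro z' hz'
    rw [hg] at hz'
    rw [← hz']
    exact huz
  by_cases hall : ∀ z, ∃ κ, ColC ψ 1 z κ
  · left
    choose κ hκ using hall
    exact ⟨κ, hκ⟩
  right
  push Not at hall
  obtain ⟨z1, hz1⟩ := hall
  have hex : ∃ n : ℕ, ∃ u z, hd u⁻¹ ≠ some z ∧ (∀ κ, ¬ ColC ψ u z κ) ∧ R ≤ u.norm + n :=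
    ⟨R, 1, z1, by rw [inv_one, hd_one]; simp, hz1, by omega⟩
  obtain ⟨u0, z0, h0, hbad, hn⟩ := Nat.find_spec hex
  set n := Nat.find hex with hndef
  have hlt : u0.norm < R := by
    by_contra h
    exact hbad _ (hfar u0 z0 h0 (by omega))
  have hgood : ∀ z, z ≠ linv z0 → ∃ κ, ColC ψ (u0 * lel z0) z κ := by
    intro z hz
    by_contra hcon
    push Not at hcon
    have := Nat.find_min hex (m := n - 1) (by omega)
    apply this
    refine ⟨u0 * lel z0, z, ?_, hcon, ?_⟩
    · rw [hd_mul_lel_inv h0]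
      intro h; exact hz (Option.some.inj h).symm
    · rw [norm_mul_lel h0]; omega
  have hK : Nonempty K := ⟨ψ 1⟩
  have hgood' : ∀ z, ∃ κ, z ≠ linv z0 → ColC ψ (u0 * lel z0) z κ := by
    intro z
    by_cases h : z ≠ linv z0
    · obtain ⟨κ, hκ⟩ := hgood z h
      exact ⟨κ, fun _ => hκ⟩
    · exact ⟨ψ 1, fun h' => absurd h' h⟩
  choose κ hκ using hgood'
  refine ⟨u0 * lel z0, linv z0, κ, hd_mul_lel_inv h0, hκ, ?_⟩
  by_contra hcon
  push Not at hcon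
  apply hbad (κ z0)
  have hfinU : ({1} ∪ ⋃ z : X × Bool, {g | (z ≠ linv z0) ∧ hd g = some z ∧
      ψ (u0 * lel z0 * g) ≠ κ z} : Set (FreeGroup X)).Finite := by
    apply (Set.finite_singleton _).union
    apply Set.finite_iUnion
    intro z
    by_cases h : z ≠ linv z0
    · exact (hκ z h).subset (fun g hg => ⟨hg.2.1, hg.2.2⟩)
    · convert Set.finite_empty
      rw [Set.eq_empty_iff_forall_notMem]
      rintro g ⟨hg, _⟩
      exact h hg
  apply (hfinU.image (fun g => lel z0 * g)).subset
  rintro g ⟨hg, hne⟩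
  obtain ⟨g', rfl, hg'⟩ := hd_split hg
  refine ⟨g', ?_, rfl⟩
  cases hh : hd g' with
  | none => left; exact hd_eq_none hh
  | some z =>
    right
    rw [Set.mem_iUnion]
    have hz : z ≠ linv z0 := by
      rintro rfl; exact hg' hh
    refine ⟨z, hz, hh, ?_⟩
    rw [mul_assoc, hcon z z0 hz (linv_ne z0).symm]
    exact hne

lemma norm_wprod (y : ℕ → X × Bool) (hcyc : ∀ i, linv (y i) ≠ y (i + 1)) (n : ℕ) :
    (wprod y n).norm = n := by
  simp [FreeGroup.norm, toWord_wprod y hcyc]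

lemma zpow_inj (y : ℕ → X × Bool) (L : ℕ) (hL : 0 < L) (hper : Function.Periodic y L)
    (hcyc : ∀ i, linv (y i) ≠ y (i + 1)) {m n : ℕ} (h : wprod y L ^ m = wprod y L ^ n) : m = n := by
  have := congrArg FreeGroup.norm h
  rw [wprod_pow y L hper, wprod_pow y L hper, norm_wprod y hcyc, norm_wprod y hcyc] at this
  exact Nat.eq_of_mul_eq_mul_right hL this

lemma eventually_pos {K : Type} (ψ : FreeGroup X → K) (v : FreeGroup X) (y : ℕ → X × Bool) (L : ℕ)
    (hL : 0 < L) (hper : Function.Periodic y L)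
    (hcyc : ∀ i, linv (y i) ≠ y (i + 1)) (i : ℕ) (κ : K) (h : ColC ψ v (y (i + 1)) κ) :
    ∃ n : ℕ, 2 ≤ n ∧ ψ (v * ((wprod y (i + 1))⁻¹ * wprod y L ^ (n : ℤ))) = κ := by
  have hinj : Function.Injective
      (fun n : ℕ => (wprod y (i + 1))⁻¹ * wprod y L ^ (n : ℤ)) := by
    intro m n hmn
    simp only [mul_right_inj, zpow_natCast] at hmn
    exact zpow_inj y L hL hper hcyc hmn
  obtain ⟨B, hB⟩ := (h.preimage hinj.injOn).bddAbove
  refine ⟨B + i + 2, by omega, ?_⟩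
  by_contra hne
  have h1 : hd ((wprod y (i + 1))⁻¹ * wprod y L ^ ((B + i + 2 : ℕ) : ℤ)) = some (y (i + 1)) := by
    apply hd_line_pos y L hper hcyc
    nlinarith
  have := hB (show B + i + 2 ∈ _ from ⟨h1, hne⟩)
  omega

lemma eventually_neg {K : Type} (ψ : FreeGroup X → K) (v : FreeGroup X) (y : ℕ → X × Bool) (L : ℕ)
    (hL : 0 < L) (hper : Function.Periodic y L)
    (hcyc : ∀ i, linv (y i) ≠ y (i + 1)) (i : ℕ) (κ : K) (h : ColC ψ v (linv (y i)) κ) :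
    ∃ n : ℕ, 1 ≤ n ∧ ψ (v * ((wprod y (i + 1))⁻¹ * wprod y L ^ (-(n : ℤ)))) = κ := by
  have hinj : Function.Injective
      (fun n : ℕ => (wprod y (i + 1))⁻¹ * wprod y L ^ (-(n : ℤ))) := by
    intro m n hmn
    simp only [mul_right_inj, zpow_natCast, zpow_neg, inv_inj] at hmn
    exact zpow_inj y L hL hper hcyc hmn
  obtain ⟨B, hB⟩ := (h.preimage hinj.injOn).bddAbove
  refine ⟨B + 1, by omega, ?_⟩
  by_contra hne
  have h1 := hd_line_neg y L hper hcyc i (B + 1)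
  have := hB (show B + 1 ∈ _ from ⟨h1, hne⟩)
  omega

lemma line_const {G K : Type} [Group G] (ψ : G → K) (w c : G)
    (hw : ∀ r, r ≠ 1 → ψ (r * w) = ψ r) (h : ∀ n : ℤ, c * w ^ n ≠ 1) (n : ℤ) :
    ψ (c * w ^ n) = ψ c := by
  induction n with
  | zero => simp
  | succ i ih => rw [zpow_add_one, ← mul_assoc, hw _ (h _), ih]
  | pred i ih =>
    rw [← ih, ← hw _ (h (-i - 1)), mul_assoc, ← zpow_add_one, sub_add_cancel]

lemma pow_pos_const {G K : Type} [Group G] (ψ : G → K) (w : G)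
    (hw : ∀ r, r ≠ 1 → ψ (r * w) = ψ r) (h : ∀ n : ℕ, 1 ≤ n → w ^ n ≠ 1) (n : ℕ) :
    ψ (w ^ (n + 1)) = ψ w := by
  induction n with
  | zero => simp
  | succ i ih => rw [pow_succ, hw _ (h _ (by omega)), ih]

lemma pow_neg_const {G K : Type} [Group G] (ψ : G → K) (w : G)
    (hw : ∀ r, r ≠ 1 → ψ (r * w) = ψ r) (h : ∀ n : ℕ, 1 ≤ n → w ^ n ≠ 1) (n : ℕ) :
    ψ ((w ^ n)⁻¹) = ψ 1 := by
  induction n with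
  | zero => simp
  | succ i ih =>
    rw [← ih, ← hw ((w ^ (i + 1))⁻¹) (inv_ne_one.2 (h _ (by omega)))]
    congr 1
    rw [pow_succ']; group

/-- One reduction step. -/
theorem step [Finite X] {K : Type} (ψ : FreeGroup X → K)
    (hfin : ∀ g, {r | ψ (r * g) ≠ ψ r}.Finite) (w : FreeGroup X)
    (hw : ∀ r, r ≠ 1 → ψ (r * w) = ψ r) (hw1 : ψ w ≠ ψ 1)
    (hc : FreeGroup.IsCyclicallyReduced w.toWord)
    (hused : ∀ x, ∃ s, (x, s) ∈ w.toWord) :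
    (∃ α : FreeGroup X ≃* FreeGroup X, (α w).norm < w.norm) ∨
    ∃ (e : FreeGroup X ≃* FreeGroup X) (x : X), e (FreeGroup.of x) = w := by
  have hne1 : w ≠ 1 := by rintro rfl; exact hw1 rfl
  obtain ⟨y, hper, hcyc, hyw, hyu⟩ := exists_seq w hne1 hc
  have hL : 0 < w.norm := Nat.pos_of_ne_zero (by rwa [ne_eq, FreeGroup.norm_eq_zero])
  generalize w.norm = L at *
  subst hyw
  rcases dichotomy ψ hfin with ⟨κ, hκ⟩ | ⟨v, a, κ, hva, hκ, hbc⟩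
  · have hpow : ∀ n : ℕ, 1 ≤ n → wprod y L ^ n ≠ 1 := by
      intro n hn h
      have := zpow_inj y L hL hper hcyc (m := n) (n := 0) (by simpa using h)
      omega
    apply root_case L hL y hper hcyc κ
    · intro i hi
      obtain ⟨n, _, hn⟩ := eventually_pos ψ 1 y L hL hper hcyc i _ (hκ _)
      obtain ⟨m, _, hm⟩ := eventually_neg ψ 1 y L hL hper hcyc i _ (hκ _)
      rw [one_mul] at hn hm
      rw [← hn, ← hm]
      have hl : ∀ n : ℤ, (wprod y (i + 1))⁻¹ * wprod y L ^ n ≠ 1 := by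
        intro n
        obtain ⟨m, rfl | rfl⟩ := n.eq_nat_or_neg
        · rcases lt_trichotomy (m * L) (i + 1) with h | h | h
          · exact hd_ne_one (hd_line_mid y L hper hcyc i m h)
          · exfalso
            rcases Nat.eq_zero_or_pos m with rfl | hm
            · omega
            · nlinarith
          · exact hd_ne_one (hd_line_pos y L hper hcyc i m h)
        · exact hd_ne_one (hd_line_neg y L hper hcyc i m)
      rw [line_const ψ _ _ hw hl, line_const ψ _ _ hw hl]
    · obtain ⟨n, hn0, hn⟩ := eventually_pos ψ 1 y L hL hper hcyc (L - 1) _ (hκ _)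
      obtain ⟨m, _, hm⟩ := eventually_neg ψ 1 y L hL hper hcyc (L - 1) _ (hκ _)
      rw [one_mul, Nat.sub_add_cancel hL] at hn hm
      have h0 : y L = y 0 := by simpa using hper 0
      rw [h0] at hn
      have hn2 : κ (y 0) = ψ (wprod y L) := by
        obtain ⟨j, rfl⟩ : ∃ j, n = j + 2 := ⟨n - 2, by omega⟩
        rw [← hn, ← pow_pos_const ψ _ hw hpow j]
        congr 1
        rw [zpow_natCast, pow_succ' _ (j + 1), inv_mul_cancel_left]
      have hm2 : κ (linv (y (L - 1))) = ψ 1 := by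
        rw [← hm, ← pow_neg_const ψ _ hw hpow (m + 1)]
        congr 1
        rw [zpow_neg, zpow_natCast, pow_succ, mul_inv_rev]
      rw [hn2, hm2]
      exact hw1.symm
  · left
    apply branch_case L hL y hper hcyc κ a _ hbc
    · intro x
      obtain ⟨s, hs⟩ := hused x
      obtain ⟨i, hi⟩ := hyu _ hs
      exact ⟨i, by rw [hi]⟩
    · intro i h1 h2
      obtain ⟨n, _, hn⟩ := eventually_pos ψ v y L hL hper hcyc i _ (hκ _ h2)
      obtain ⟨m, _, hm⟩ := eventually_neg ψ v y L hL hper hcyc i _ (hκ _ h1)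
      rw [← mul_assoc] at hn hm
      rw [← hn, ← hm]
      have hl : ∀ n : ℤ, v * (wprod y (i + 1))⁻¹ * wprod y L ^ n ≠ 1 := by
        intro n h
        rw [mul_assoc] at h
        have h3 := inv_eq_of_mul_eq_one_right h
        have h4 := hd_line y L hper hcyc i n _ h3 (hd_ne_one hva)
        rw [hva] at h4
        rcases h4 with h4 | h4
        · exact h2 (Option.some.inj h4).symm
        · exact h1 (Option.some.inj h4).symm
      rw [line_const ψ _ _ hw hl, line_const ψ _ _ hw hl]

end PW

namespace PW

variable {X : Type} [DecidableEq X]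

/-- Extend an endomorphism of the free group on the complement of `x` by fixing `x`. -/
def extHom (x : X) (f : FreeGroup {x' : X // x' ≠ x} →* FreeGroup {x' : X // x' ≠ x}) :
    FreeGroup X →* FreeGroup X :=
  FreeGroup.lift (fun z => if h : z ≠ x then FreeGroup.map Subtype.val (f (FreeGroup.of ⟨z, h⟩))
    else FreeGroup.of x)

lemma extHom_of (x : X) (f : FreeGroup {x' : X // x' ≠ x} →* FreeGroup {x' : X // x' ≠ x}) :
    extHom x f (FreeGroup.of x) = FreeGroup.of x := by
  simp [extHom]

lemma extHom_map (x : X) (f : FreeGroup {x' : X // x' ≠ x} →* FreeGroup {x' : X // x' ≠ x})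
    (g : FreeGroup {x' : X // x' ≠ x}) :
    extHom x f (FreeGroup.map Subtype.val g) = FreeGroup.map Subtype.val (f g) := by
  have : (extHom x f).comp (FreeGroup.map Subtype.val) =
      (FreeGroup.map Subtype.val).comp f := by
    apply FreeGroup.ext_hom
    intro z
    have hz := z.2
    simp [extHom, hz]
  exact DFunLike.congr_fun this g

lemma extHom_inv (x : X) (e : FreeGroup {x' : X // x' ≠ x} ≃* FreeGroup {x' : X // x' ≠ x}) :
    (extHom x e.symm.toMonoidHom).comp (extHom x e.toMonoidHom) = MonoidHom.id _ := by
  apply FreeGroup.ext_hom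
  intro z
  by_cases hz : z = x
  · subst hz
    simp [extHom_of]
  · have : FreeGroup.of z = FreeGroup.map Subtype.val (FreeGroup.of (⟨z, hz⟩ : {x' : X // x' ≠ x})) := by
      simp
    rw [this, MonoidHom.comp_apply, extHom_map, extHom_map]
    simp

/-- Automorphism version of `extHom`. -/
def extEquiv (x : X) (e : FreeGroup {x' : X // x' ≠ x} ≃* FreeGroup {x' : X // x' ≠ x}) :
    FreeGroup X ≃* FreeGroup X :=
  MonoidHom.toMulEquiv (extHom x e.toMonoidHom) (extHom x e.symm.toMonoidHom)
    (extHom_inv x e) (extHom_inv x e.symm)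

lemma exists_preimage (x : X) (l : List (X × Bool)) (h : ∀ s, (x, s) ∉ l) :
    ∃ l' : List ({x' : X // x' ≠ x} × Bool), l'.length = l.length ∧
      l'.map (fun z => ((z.1 : X), z.2)) = l := by
  induction l with
  | nil => exact ⟨[], rfl, rfl⟩
  | cons z l ih =>
    obtain ⟨l', h1, h2⟩ := ih (fun s hs => h s (List.mem_cons_of_mem _ hs))
    refine ⟨(⟨z.1, ?_⟩, z.2) :: l', by simp [h1], by simp [h2]⟩
    intro hz
    apply h z.2
    rw [← hz]
    exact List.mem_cons_self

lemma exists_reducing (w : FreeGroup X) (hw : ¬ FreeGroup.IsCyclicallyReduced w.toWord) :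
    ∃ α : FreeGroup X ≃* FreeGroup X, (α w).norm < w.norm := by
  have h := FreeGroup.reduceCyclically.conj_conjugator_reduceCyclically w.toWord
  set c := FreeGroup.reduceCyclically.conjugator w.toWord
  set r := FreeGroup.reduceCyclically w.toWord with hr
  refine ⟨MulAut.conj (FreeGroup.mk c)⁻¹, ?_⟩
  have h2 : w = FreeGroup.mk c * FreeGroup.mk r * (FreeGroup.mk c)⁻¹ := by
    rw [FreeGroup.inv_mk, FreeGroup.mul_mk, FreeGroup.mul_mk, h, FreeGroup.mk_toWord]
  have h3 : MulAut.conj (FreeGroup.mk c)⁻¹ w = FreeGroup.mk r := by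
    rw [MulAut.conj_apply, inv_inv]
    conv_lhs => rw [h2]
    group
  rw [h3]
  have h4 : (FreeGroup.mk r).norm ≤ r.length := FreeGroup.norm_mk_le
  have h5 : w.norm = c.length + r.length + c.length := by
    rw [FreeGroup.norm, ← h]; simp; omega
  rcases Nat.eq_zero_or_pos c.length with h0 | h0
  · exfalso
    apply hw
    rw [List.length_eq_zero_iff] at h0
    rw [h0] at h
    simp at h
    rw [← h]
    exact FreeGroup.reduceCyclically.isCyclicallyReduced FreeGroup.isReduced_toWord
  · omega

theorem combinatorial_aux (N : ℕ) : ∀ (X : Type) [DecidableEq X] [Finite X] (K : Type)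
    (w : FreeGroup X) (ψ : FreeGroup X → K)
    (_ : Nat.card X + w.norm = N)
    (_ : ∀ g, {r | ψ (r * g) ≠ ψ r}.Finite)
    (_ : ∀ r, r ≠ 1 → ψ (r * w) = ψ r) (_ : ψ w ≠ ψ 1),
    ∃ (e : FreeGroup X ≃* FreeGroup X) (x : X), e (FreeGroup.of x) = w := by
  induction N using Nat.strong_induction_on with
  | _ N ih =>
  intro X _ _ K w ψ hN hfin hw hw1
  by_cases hred : ∃ α : FreeGroup X ≃* FreeGroup X, (α w).norm < w.norm
  · obtain ⟨α, hα⟩ := hred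
    obtain ⟨e, x, hex⟩ := ih (Nat.card X + (α w).norm) (by omega) X K (α w) (fun g => ψ (α.symm g))
      rfl (by
        intro g
        apply ((hfin (α.symm g)).preimage (f := α.symm) α.symm.injective.injOn).subset
        intro r hr
        simpa using hr) (by
        intro r hr
        simp only [map_mul, MulEquiv.symm_apply_apply]
        exact hw _ (by simpa using hr)) (by simpa using hw1)
    exact ⟨e.trans α.symm, x, by simp [hex]⟩
  have hc : FreeGroup.IsCyclicallyReduced w.toWord := by
    by_contra h
    exact hred (exists_reducing w h)
  by_cases hused : ∀ x, ∃ s, (x, s) ∈ w.toWord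
  · exact (step ψ hfin w hw hw1 hc hused).resolve_left hred
  push Not at hused
  obtain ⟨x, hx⟩ := hused
  obtain ⟨l, hl1, hl2⟩ := exists_preimage x w.toWord hx
  have hmap : FreeGroup.map Subtype.val (FreeGroup.mk l) = w := by
    rw [FreeGroup.map.mk, hl2, FreeGroup.mk_toWord]
  have hinj : Function.Injective (FreeGroup.map (Subtype.val : {x' : X // x' ≠ x} → X)) :=
    FreeGroup.map_injective Subtype.val_injective
  have hcard : Nat.card {x' : X // x' ≠ x} < Nat.card X := by
    exact Finite.card_subtype_lt (x := x) (by simp)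
  have hnorm : (FreeGroup.mk l).norm ≤ w.norm := by
    rw [FreeGroup.norm, FreeGroup.norm, ← hl1]
    exact FreeGroup.norm_mk_le
  obtain ⟨e, x', hex⟩ := ih _ (by omega) {x' : X // x' ≠ x} K (FreeGroup.mk l)
    (fun g => ψ (FreeGroup.map Subtype.val g)) rfl (by
      intro g
      apply ((hfin (FreeGroup.map Subtype.val g)).preimage hinj.injOn).subset
      intro r hr
      simpa using hr) (by
      intro r hr
      simp only [map_mul, hmap]
      apply hw
      intro h
      exact hr (hinj (by simpa using h))) (by rw [hmap, map_one]; exact hw1)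
  refine ⟨extEquiv x e, x', ?_⟩
  have h1 : FreeGroup.of (x' : X) = FreeGroup.map Subtype.val (FreeGroup.of x') := by simp
  rw [h1, ← hmap, ← hex]
  exact extHom_map x e.toMonoidHom (FreeGroup.of x')

theorem combinatorial {X : Type} [Finite X] {K : Type}
    (w : FreeGroup X) (ψ : FreeGroup X → K)
    (hfin : ∀ g, {r | ψ (r * g) ≠ ψ r}.Finite)
    (hw : ∀ r, r ≠ 1 → ψ (r * w) = ψ r) (hw1 : ψ w ≠ ψ 1) :
    ∃ (e : FreeGroup X ≃* FreeGroup X) (x : X), e (FreeGroup.of x) = w := by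
  classical
  exact combinatorial_aux _ X K w ψ rfl hfin hw hw1

end PW

namespace PW

/-- The semidirect product of an additive group with a group acting on it. -/
@[ext] structure SD {B Γ : Type} [AddCommGroup B] [Group Γ] (act : Γ →* AddMonoid.End B) where
  fst : B
  snd : Γ

section SD
variable {B Γ : Type} [AddCommGroup B] [Group Γ] (act : Γ →* AddMonoid.End B)

instance : Mul (SD act) := ⟨fun p q => ⟨p.fst + act p.snd q.fst, p.snd * q.snd⟩⟩
instance : One (SD act) := ⟨⟨0, 1⟩⟩
instance : Inv (SD act) := ⟨fun p => ⟨-act p.snd⁻¹ p.fst, p.snd⁻¹⟩⟩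

@[simp] lemma SD.mul_fst (p q : SD act) : (p * q).fst = p.fst + act p.snd q.fst := rfl
@[simp] lemma SD.mul_snd (p q : SD act) : (p * q).snd = p.snd * q.snd := rfl
@[simp] lemma SD.one_fst : (1 : SD act).fst = 0 := rfl
@[simp] lemma SD.one_snd : (1 : SD act).snd = 1 := rfl
@[simp] lemma SD.inv_fst (p : SD act) : (p⁻¹).fst = -act p.snd⁻¹ p.fst := rfl
@[simp] lemma SD.inv_snd (p : SD act) : (p⁻¹).snd = p.snd⁻¹ := rfl

instance : Group (SD act) :=
  Group.ofLeftAxioms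
    (by
      intro a b c
      ext
      · simp [add_assoc]
      · simp [mul_assoc])
    (by
      intro a
      ext <;> simp)
    (by
      intro a
      ext <;> simp)

/-- Projection of the semidirect product. -/
def SD.proj : SD act →* Γ where
  toFun := SD.snd
  map_one' := rfl
  map_mul' _ _ := rfl

instance [Finite B] [Finite Γ] : Finite (SD act) :=
  Finite.of_injective (fun p : SD act => (p.fst, p.snd)) (by
    intro p q h
    simp only [Prod.mk.injEq] at h
    exact SD.ext h.1 h.2)

end SD

/-- Crossed homomorphisms. -/
def IsCrossed {B F : Type} [AddCommGroup B] [Group F] (act : F →* AddMonoid.End B)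
    (δ : F → B) : Prop := ∀ g h, δ (g * h) = δ g + act g (δ h)

lemma IsCrossed.one {B F : Type} [AddCommGroup B] [Group F] {act : F →* AddMonoid.End B}
    {δ : F → B} (h : IsCrossed act δ) : δ 1 = 0 := by
  have := h 1 1
  simpa using this

lemma IsCrossed.inv {B F : Type} [AddCommGroup B] [Group F] {act : F →* AddMonoid.End B}
    {δ : F → B} (h : IsCrossed act δ) (g : F) : δ g⁻¹ = - act g⁻¹ (δ g) := by
  have := h g⁻¹ g
  rw [inv_mul_cancel, h.one] at this
  exact eq_neg_of_add_eq_zero_left this.symm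

lemma IsCrossed.eq {B X : Type} [AddCommGroup B] {act : FreeGroup X →* AddMonoid.End B}
    {δ δ' : FreeGroup X → B} (h : IsCrossed act δ) (h' : IsCrossed act δ')
    (hx : ∀ x, δ (FreeGroup.of x) = δ' (FreeGroup.of x)) (g : FreeGroup X) : δ g = δ' g := by
  induction g using FreeGroup.induction_on with
  | C1 => rw [h.one, h'.one]
  | of x => exact hx x
  | inv_of x _ => rw [h.inv, h'.inv, hx]
  | mul a b ha hb => rw [h, h', ha, hb]

lemma exists_crossed {B X : Type} [AddCommGroup B] (act : FreeGroup X →* AddMonoid.End B)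
    (c : X → B) : ∃ δ : FreeGroup X → B, IsCrossed act δ ∧ ∀ x, δ (FreeGroup.of x) = c x := by
  let f : FreeGroup X →* SD act := FreeGroup.lift (fun x => ⟨c x, FreeGroup.of x⟩)
  have hf : (SD.proj act).comp f = MonoidHom.id _ := by
    apply FreeGroup.ext_hom
    intro x
    simp [f, SD.proj]
  refine ⟨fun g => (f g).fst, ?_, ?_⟩
  · intro g h
    have h2 : (f g).snd = g := DFunLike.congr_fun hf g
    change (f (g * h)).fst = (f g).fst + act g (f h).fst
    rw [map_mul, SD.mul_fst, h2]
  · intro x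
    simp [f]

/-- The group algebra over the field with two elements. -/
abbrev GA (X : Type) := MonoidAlgebra (ZMod 2) (FreeGroup X)

/-- Right multiplication action. -/
noncomputable def ract (X : Type) : FreeGroup X →* AddMonoid.End (GA X) where
  toFun g := AddMonoidHom.mulRight (MonoidAlgebra.of (ZMod 2) (FreeGroup X) g⁻¹)
  map_one' := by
    apply AddMonoidHom.ext
    intro a
    change a * _ = a
    rw [inv_one, map_one, mul_one]
  map_mul' g h := by
    apply AddMonoidHom.ext
    intro a
    change a * _ = a * _ * _
    rw [mul_inv_rev, map_mul, mul_assoc]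

lemma ract_apply (X : Type) (g : FreeGroup X) (a : GA X) :
    ract X g a = a * MonoidAlgebra.of (ZMod 2) (FreeGroup X) g⁻¹ := rfl

open Classical in
/-- Kronecker delta. -/
noncomputable def kron {R X : Type} [Zero R] [One R] (x y : X) : R := if y = x then 1 else 0

/-- Fox derivatives. -/
noncomputable def fox {X : Type} (x : X) : FreeGroup X → GA X :=
  (exists_crossed (ract X) (kron x)).choose

lemma fox_crossed {X : Type} (x : X) : IsCrossed (ract X) (fox x) :=
  (exists_crossed (ract X) (kron x)).choose_spec.1

lemma fox_of {X : Type} (x y : X) : fox x (FreeGroup.of y) = kron x y :=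
  (exists_crossed (ract X) (kron x)).choose_spec.2 y

/-- The left ideal generated by Fox derivatives of `w`. -/
noncomputable def foxI {X : Type} (w : FreeGroup X) : Submodule (GA X) (GA X) :=
  Submodule.span (GA X) (Set.range (fun x => fox x w))

theorem primitive_of_one_mem {X : Type} [Finite X] (w : FreeGroup X)
    (h : (1 : GA X) ∈ foxI w) :
    ∃ (e : FreeGroup X ≃* FreeGroup X) (x : X), e (FreeGroup.of x) = w := by
  classical
  have := Fintype.ofFinite X
  rw [foxI, Submodule.mem_span_range_iff_exists_fun] at h
  obtain ⟨c, hc⟩ := h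
  let δ : FreeGroup X → GA X := fun g => ∑ x, c x * fox x g
  have hδ : ∀ g h, δ (g * h) = δ g + δ h * MonoidAlgebra.of (ZMod 2) (FreeGroup X) g⁻¹ := by
    intro g h
    simp only [δ, Finset.sum_mul, ← Finset.sum_add_distrib]
    apply Finset.sum_congr rfl
    intro x _
    rw [fox_crossed x g h, ract_apply, mul_add, mul_assoc]
  have hw : δ w = 1 := by simpa [δ] using hc
  have key : ∀ r g, (δ (r * g)).coeff 1 = (δ r).coeff 1 + (δ g).coeff r := by
    intro r g
    rw [hδ]
    have : (δ g * MonoidAlgebra.of (ZMod 2) (FreeGroup X) r⁻¹).coeff 1 = (δ g).coeff r := by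
      rw [MonoidAlgebra.of_apply]
      simp [MonoidAlgebra.coeff_mul_single_apply]
    simp [this]
  apply combinatorial w (fun g => (δ g).coeff 1)
  · intro g
    apply (δ g).coeff.support.finite_toSet.subset
    intro r hr
    simp only [Set.mem_ofPred_eq, key] at hr
    simpa using hr
  · intro r hr
    rw [key, hw]
    simp [MonoidAlgebra.one_def, Finsupp.single_apply, hr.symm]
  · have h1 : δ 1 = 0 := by
      have := hδ 1 1
      simpa only [inv_one, map_one, mul_one, left_eq_add] using this
    simp only [h1, hw]
    simp [MonoidAlgebra.one_def]

end PW

namespace PW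

lemma extend_inj {K V : Type} [Field K] [AddCommGroup V] [Module K V] [FiniteDimensional K V]
    (U : Submodule K V) (f : U →ₗ[K] V) (hf : Function.Injective f) :
    ∃ e : V ≃ₗ[K] V, ∀ u : U, e u = f u := by
  obtain ⟨U', hU⟩ := Submodule.exists_isCompl U
  obtain ⟨W', hW⟩ := Submodule.exists_isCompl (LinearMap.range f)
  have e1 : U ≃ₗ[K] LinearMap.range f := LinearEquiv.ofInjective f hf
  have h1 := Submodule.finrank_add_eq_of_isCompl hU
  have h2 := Submodule.finrank_add_eq_of_isCompl hW
  have h3 := e1.finrank_eq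
  have e2 : U' ≃ₗ[K] W' := LinearEquiv.ofFinrankEq _ _ (by omega)
  refine ⟨(Submodule.prodEquivOfIsCompl U U' hU).symm ≪≫ₗ
    (LinearEquiv.prodCongr (LinearEquiv.ofInjective f hf) e2) ≪≫ₗ
    Submodule.prodEquivOfIsCompl _ W' hW, ?_⟩
  intro u
  simp [Submodule.prodEquivOfIsCompl_symm_apply_left]

lemma extend_sub {K M : Type} [Field K] [AddCommGroup M] [Module K M] (V : Submodule K M)
    [FiniteDimensional K V] (f : M →ₗ[K] M) (hf : Function.Injective f) :
    ∃ e : V ≃ₗ[K] V, ∀ v : V, f v ∈ V → (e v : M) = f v := by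
  let U : Submodule K V := V.comap (f.comp V.subtype)
  let f' : U →ₗ[K] V := LinearMap.codRestrict V ((f.comp V.subtype).comp U.subtype) (fun u => u.2)
  obtain ⟨e, he⟩ := extend_inj U f' (by
    intro a b hab
    have h1 : f (a : V) = f (b : V) := congrArg Subtype.val hab
    exact Subtype.ext (Subtype.ext (hf h1)))
  refine ⟨e, fun v hv => ?_⟩
  have := he ⟨v, hv⟩
  exact congrArg Subtype.val this

lemma mk_take_succ {X : Type} (l : List (X × Bool)) (i : ℕ) (hi : i < l.length) :
    FreeGroup.mk (l.take (i + 1)) = FreeGroup.mk (l.take i) * lel l[i] := by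
  rw [lel, FreeGroup.mul_mk, List.take_append_getElem]

theorem exists_rep {X M : Type} [AddCommGroup M] [Module (ZMod 2) M]
    (lam : FreeGroup X →* Module.End (ZMod 2) M) (v0 : M) (l : List (X × Bool)) :
    ∃ V : Submodule (ZMod 2) M, FiniteDimensional (ZMod 2) V ∧
      ∃ (ρ : FreeGroup X →* (V ≃ₗ[ZMod 2] V)) (u0 : V), (u0 : M) = v0 ∧
      ∀ i ≤ l.length, ((ρ (FreeGroup.mk (l.take i))⁻¹ u0 : V) : M) =
        lam (FreeGroup.mk (l.take i))⁻¹ v0 := by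
  let p : ℕ → FreeGroup X := fun i => FreeGroup.mk (l.take i)
  let V : Submodule (ZMod 2) M :=
    Submodule.span (ZMod 2) (Set.range (fun i : Fin (l.length + 1) => lam (p i)⁻¹ v0))
  have hV : ∀ i ≤ l.length, lam (p i)⁻¹ v0 ∈ V := fun i hi =>
    Submodule.subset_span ⟨⟨i, by omega⟩, rfl⟩
  have hfd : FiniteDimensional (ZMod 2) V := FiniteDimensional.span_of_finite _ (Set.finite_range _)
  have hcan : ∀ g v, lam g⁻¹ (lam g v) = v := by
    intro g v
    rw [← Module.End.mul_apply, ← map_mul, inv_mul_cancel, map_one]; rfl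
  have hinj : ∀ g, Function.Injective (lam g) := by
    intro g a b hab
    rw [← hcan g a, hab, hcan]
  choose e he using fun x : X => extend_sub V (lam (FreeGroup.of x)) (hinj _)
  have h0 : v0 ∈ V := by
    have := hV 0 (by omega)
    have hp : p 0 = 1 := rfl
    rw [hp, inv_one, map_one] at this
    exact this
  refine ⟨V, hfd, FreeGroup.lift e, ⟨v0, h0⟩, rfl, ?_⟩
  intro i
  induction i with
  | zero =>
    intro _
    have hp : FreeGroup.mk (l.take 0) = 1 := rfl
    rw [hp, inv_one, map_one, map_one]; rfl
  | succ i ih =>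
    intro hi
    have ih := ih (by omega)
    have hV1 := hV (i + 1) hi
    have hV0 := hV i (by omega)
    have hs : p (i + 1) = p i * lel l[i] := mk_take_succ l i (by omega)
    change (((FreeGroup.lift e) (p i)⁻¹ ⟨v0, h0⟩ : V) : M) = lam (p i)⁻¹ v0 at ih
    change (((FreeGroup.lift e) (p (i + 1))⁻¹ ⟨v0, h0⟩ : V) : M) = lam (p (i + 1))⁻¹ v0
    rw [hs, mul_inv_rev, map_mul, map_mul, Module.End.mul_apply, LinearEquiv.mul_apply, ← ih]
    rw [hs, mul_inv_rev, map_mul, Module.End.mul_apply, ← ih] at hV1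
    generalize (FreeGroup.lift e) (p i)⁻¹ ⟨v0, h0⟩ = u at hV1 ⊢
    generalize l[i] = a at hV1 ⊢
    obtain ⟨x, b⟩ := a
    cases b
    · rw [lel_false, inv_inv] at hV1 ⊢
      rw [FreeGroup.lift_apply_of]
      exact he x u hV1
    · rw [lel_true] at hV1 ⊢
      rw [map_inv, FreeGroup.lift_apply_of]
      have h5 : lam (FreeGroup.of x) (lam (FreeGroup.of x)⁻¹ u) = u := by
        have := hcan (FreeGroup.of x)⁻¹ u
        rwa [inv_inv] at this
      have h6 := he x ⟨_, hV1⟩ (by rw [h5]; exact u.2)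
      have h7 : e x ⟨_, hV1⟩ = u := Subtype.ext (by rw [h6, h5])
      have h8 : (e x)⁻¹ u = ⟨_, hV1⟩ := (LinearEquiv.symm_apply_eq _).2 h7.symm
      rw [h8]

/-- Precomposition action. -/
def preact {Γ S : Type} (B : Type) [Group Γ] [AddCommGroup B] (s : Γ → S → S) (h1 : ∀ x, s 1 x = x)
    (hmul : ∀ g h x, s (g * h) x = s h (s g x)) : Γ →* AddMonoid.End (S → B) where
  toFun g :=
    { toFun := fun f x => f (s g x)
      map_zero' := rfl
      map_add' := fun _ _ => rfl }
  map_one' := by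
    apply AddMonoidHom.ext
    intro f
    funext x
    exact congrArg f (h1 x)
  map_mul' g h := by
    apply AddMonoidHom.ext
    intro f
    funext x
    exact congrArg f (hmul g h x)

/-- The regular action `(g • b) r = b (r * g)`. -/
def regact (Q : Type) [Group Q] : Q →* AddMonoid.End (Q → ZMod 2) :=
  preact (ZMod 2) (fun g r => r * g) (fun r => mul_one r) (fun g h r => (mul_assoc r g h).symm)

lemma regact_apply {Q : Type} [Group Q] (g : Q) (b : Q → ZMod 2) (r : Q) :
    regact Q g b r = b (r * g) := rfl

set_option maxHeartbeats 1000000 in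
theorem exists_Q {X : Type} [Finite X] (w : FreeGroup X) (h : (1 : GA X) ∉ foxI w) :
    ∃ (Q : Type) (_ : Group Q) (_ : Fintype Q) (ρ : FreeGroup X →* Q) (φ : Q → ZMod 2),
      φ 1 ≠ 0 ∧ (∀ r, φ (r * ρ w) = φ r) ∧
      ∀ δ : FreeGroup X → (Q → ZMod 2), IsCrossed ((regact Q).comp ρ) δ →
        ∑ r, δ w r * φ r = 0 := by
  classical
  have := Fintype.ofFinite X
  let M := GA X ⧸ foxI w
  let lam : FreeGroup X →* Module.End (ZMod 2) M :=
    ((Algebra.lsmul (ZMod 2) (ZMod 2) M : GA X →ₐ[ZMod 2] _) : GA X →* _).comp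
      (MonoidAlgebra.of (ZMod 2) (FreeGroup X))
  have hlam : ∀ g (a : GA X), lam g (Submodule.Quotient.mk a) =
      Submodule.Quotient.mk (MonoidAlgebra.of (ZMod 2) (FreeGroup X) g * a) := by
    intro g a
    rfl
  obtain ⟨V, hfd, ρ, u0, hu0, hpre⟩ := exists_rep lam (Submodule.Quotient.mk 1) w.toWord
  have hfinV : Finite V := Module.finite_of_finite (ZMod 2)
  have hfinQ : Finite (V ≃ₗ[ZMod 2] V) := Finite.of_injective (fun e => (e : V → V))
    DFunLike.coe_injective
  have := Fintype.ofFinite (V ≃ₗ[ZMod 2] V)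
  let actV : FreeGroup X →* AddMonoid.End (V → V) := preact V (fun g v => ρ g⁻¹ v)
    (by intro v; rw [inv_one, map_one]; rfl)
    (by intro g h v; rw [mul_inv_rev, map_mul]; rfl)
  have hact : ∀ g f v, actV g f v = f (ρ g⁻¹ v) := fun _ _ _ => rfl
  choose Θ hΘ hΘx using fun x : X => exists_crossed actV (fun y v => if y = x then v else 0)
  have claimA : ∀ x, ∀ i ≤ w.toWord.length,
      ((Θ x (FreeGroup.mk (w.toWord.take i)) u0 : V) : M) =
        Submodule.Quotient.mk (fox x (FreeGroup.mk (w.toWord.take i))) := by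
    intro x i
    induction i with
    | zero =>
      intro _
      have hp : FreeGroup.mk (w.toWord.take 0) = 1 := rfl
      rw [hp, (hΘ x).one, (fox_crossed x).one]
      rfl
    | succ i ih =>
      intro hi
      have ih := ih (by omega)
      have hp0 := hpre i (by omega)
      have hp1 := hpre (i + 1) hi
      rw [mk_take_succ _ i (by omega)] at hp1 ⊢
      rw [hΘ x, fox_crossed x, Submodule.Quotient.mk_add, ← ih, Pi.add_apply, Submodule.coe_add]
      congr 1
      generalize FreeGroup.mk (w.toWord.take i) = p at *
      generalize w.toWord[i] = a at *
      obtain ⟨y, b⟩ := a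
      rw [hact, ract_apply]
      rw [hlam, mul_one] at hp0 hp1
      cases b
      · rw [lel_false] at hp1 ⊢
        rw [(hΘ x).inv, (fox_crossed x).inv, Pi.neg_apply, hact, hΘx, fox_of, ract_apply]
        unfold kron
        rw [mul_inv_rev, map_mul, map_mul] at hp1
        by_cases hyx : y = x
        · simp only [if_pos hyx, one_mul, neg_mul, Submodule.Quotient.mk_neg, Submodule.coe_neg]
          rw [← hp1]; rfl
        · simp only [if_neg hyx]
          simp
      · rw [lel_true] at hp1 ⊢
        rw [hΘx, fox_of]
        unfold kron
        by_cases hyx : y = x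
        · simp only [if_pos hyx, one_mul]
          exact hp0
        · simp only [if_neg hyx, zero_mul]
          rfl
  have hw : FreeGroup.mk (w.toWord.take w.toWord.length) = w := by
    rw [List.take_length, FreeGroup.mk_toWord]
  have hΘw : ∀ x, Θ x w u0 = 0 := by
    intro x
    have := claimA x _ le_rfl
    rw [hw] at this
    apply Subtype.ext
    rw [this]
    exact (Submodule.Quotient.mk_eq_zero _).2 (Submodule.subset_span ⟨x, rfl⟩)
  have hfund : ∀ g : FreeGroup X, MonoidAlgebra.of (ZMod 2) (FreeGroup X) g⁻¹ - 1 =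
      ∑ x, (MonoidAlgebra.of (ZMod 2) (FreeGroup X) (FreeGroup.of x)⁻¹ - 1) * fox x g := by
    apply IsCrossed.eq (act := ract X)
    · intro g h
      beta_reduce
      rw [ract_apply, mul_inv_rev, map_mul, sub_mul, one_mul]
      abel
    · intro g h
      rw [ract_apply, Finset.sum_mul, ← Finset.sum_add_distrib]
      apply Finset.sum_congr rfl
      intro x _
      rw [fox_crossed x g h, ract_apply, mul_add, mul_assoc]
    · intro y
      rw [Finset.sum_eq_single y]
      · rw [fox_of, kron, if_pos rfl, mul_one]
      · intro x _ hx
        rw [fox_of, kron, if_neg hx.symm, mul_zero]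
      · simp
  have hρw : ρ w⁻¹ u0 = u0 := by
    have := hpre _ le_rfl
    rw [hw, hlam, mul_one] at this
    apply Subtype.ext
    rw [this, hu0]
    apply (Submodule.Quotient.eq _).2
    rw [hfund]
    apply Submodule.sum_mem
    intro x _
    exact Submodule.smul_mem _ _ (Submodule.subset_span ⟨x, rfl⟩)
  have hρw' : ρ w u0 = u0 := by
    rw [map_inv] at hρw
    exact ((LinearEquiv.symm_apply_eq _).1 hρw).symm
  have hu0ne : u0 ≠ 0 := by
    intro h0
    rw [h0] at hu0
    exact h ((Submodule.Quotient.mk_eq_zero _).1 hu0.symm)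
  obtain ⟨μ, hμ⟩ : ∃ μ : Module.Dual (ZMod 2) V, μ u0 ≠ 0 := by
    by_contra hcon
    push Not at hcon
    exact hu0ne ((Module.forall_dual_apply_eq_zero_iff (ZMod 2) u0).1 hcon)
  refine ⟨V ≃ₗ[ZMod 2] V, inferInstance, inferInstance, ρ, fun r => μ (r u0), hμ, ?_, ?_⟩
  · intro r
    beta_reduce
    rw [LinearEquiv.mul_apply, hρw']
  · intro δ hδ
    have hδ' : ∀ g h r, δ (g * h) r = δ g r + δ h (r * ρ g) := by
      intro g h r
      rw [hδ g h]; rfl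
    have heq : ∀ g : FreeGroup X, (fun v => ∑ r : V ≃ₗ[ZMod 2] V, δ g r • r v) =
        fun v => ∑ x, ∑ s : V ≃ₗ[ZMod 2] V, δ (FreeGroup.of x) s • s (Θ x g v) := by
      apply IsCrossed.eq (act := actV)
      · intro g h
        funext v
        rw [Pi.add_apply, hact]
        simp only [hδ', add_smul, Finset.sum_add_distrib]
        congr 1
        apply Fintype.sum_equiv (Equiv.mulRight (ρ g))
        intro r
        rw [Equiv.coe_mulRight, LinearEquiv.mul_apply, ← LinearEquiv.mul_apply (ρ g), ← map_mul,
          mul_inv_cancel, map_one]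
        rfl
      · intro g h
        funext v
        rw [Pi.add_apply, hact, ← Finset.sum_add_distrib]
        apply Finset.sum_congr rfl
        intro x _
        rw [← Finset.sum_add_distrib]
        apply Finset.sum_congr rfl
        intro s _
        rw [hΘ x g h, Pi.add_apply, hact, LinearEquiv.map_add s, smul_add]
      · intro y
        funext v
        rw [Finset.sum_eq_single y]
        · simp [hΘx]
        · intro x _ hx
          simp [hΘx, hx.symm]
        · simp
    have h1 := congrFun (heq w) u0
    simp only [hΘw, map_zero, smul_zero, Finset.sum_const_zero] at h1
    have h2 := congrArg μ h1
    rw [map_sum, map_zero] at h2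
    rw [← h2]
    apply Finset.sum_congr rfl
    intro r _
    rw [map_smul, smul_eq_mul]

end PW

namespace PW

open Finset in
lemma fiber_count {A B : Type} [Fintype A] [Fintype B] (a : A → ℕ) (b : B → ℕ)
    (ha : ∀ x, 0 < a x) (hb : ∀ x, 0 < b x) (c : ℕ)
    (h : ∀ d, 0 < d → #{x | a x ∣ d} = c * #{x | b x ∣ d}) (d : ℕ) :
    #{x | a x = d} = c * #{x | b x = d} := by
  have gen : ∀ {T : Type} [Fintype T] (f : T → ℕ) (d : ℕ), 0 < d →
      #{x | f x ∣ d} = ∑ e ∈ d.properDivisors, #{x | f x = e} + #{x | f x = d} := by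
    intro T _ f d hd
    rw [Finset.card_eq_sum_card_fiberwise (f := f) (t := d.divisors)]
    · rw [← Nat.insert_self_properDivisors hd.ne', Finset.sum_insert (by simp), add_comm]
      congr 1
      · apply Finset.sum_congr rfl
        intro e he
        congr 1
        ext x
        simp only [Finset.mem_filter, Finset.mem_univ, true_and]
        rw [Nat.mem_properDivisors] at he
        constructor
        · exact fun h => h.2
        · intro h; exact ⟨h ▸ he.1, h⟩
      · congr 1
        ext x
        simp only [Finset.mem_filter, Finset.mem_univ, true_and]
        constructor
        · exact fun h => h.2
        · intro h; exact ⟨h ▸ dvd_rfl, h⟩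
    · intro x hx
      simp only [Finset.coe_filter, Finset.mem_univ, true_and, Set.mem_ofPred_eq] at hx
      simp [hx, hd.ne']
  induction d using Nat.strong_induction_on with
  | _ d ih =>
  rcases Nat.eq_zero_or_pos d with rfl | hd
  · have h1 : ∀ x, a x ≠ 0 := fun x => (ha x).ne'
    have h2 : ∀ x, b x ≠ 0 := fun x => (hb x).ne'
    simp [h1, h2]
  · have h1 := h d hd
    rw [gen a d hd, gen b d hd, mul_add, Finset.mul_sum] at h1
    rw [Finset.sum_congr rfl (fun e he => ih e (Nat.mem_properDivisors.1 he).2)] at h1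
    omega

open Finset in
lemma fiber_sum {A B : Type} [Fintype A] [Fintype B] (a : A → ℕ) (b : B → ℕ)
    (ha : ∀ x, 0 < a x) (hb : ∀ x, 0 < b x) (c : ℕ)
    (h : ∀ d, 0 < d → #{x | a x ∣ d} = c * #{x | b x ∣ d}) (g : ℕ → ℕ) :
    ∑ x, g (a x) = c * ∑ x, g (b x) := by
  have h1 := fiber_count a b ha hb c h
  have gen : ∀ {T : Type} [Fintype T] (f : T → ℕ) (S : Finset ℕ), (∀ x, f x ∈ S) →
      ∑ x, g (f x) = ∑ e ∈ S, #{x | f x = e} * g e := by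
    intro T _ f S hS
    rw [← Finset.sum_fiberwise_of_maps_to (g := f) (t := S) (fun x _ => hS x)]
    apply Finset.sum_congr rfl
    intro e _
    rw [Finset.sum_congr rfl (g := fun _ => g e), Finset.sum_const, smul_eq_mul]
    intro x hx
    rw [(Finset.mem_filter.1 hx).2]
  set S := univ.image a ∪ univ.image b
  rw [gen a S (by simp [S]), gen b S (by simp [S]), Finset.mul_sum]
  apply Finset.sum_congr rfl
  intro e _
  rw [h1, mul_assoc]

/-- Coset decomposition. -/
lemma coset_decomp {Q : Type} [Group Q] [Finite Q] (q : Q) :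
    Function.Bijective (fun p : (Q ⧸ Subgroup.zpowers q) × Fin (orderOf q) =>
      p.1.out * q ^ (p.2 : ℕ)) := by
  constructor
  · rintro ⟨c, i⟩ ⟨c', i'⟩ h
    simp only at h
    have hc : c = c' := by
      have h1 := congrArg (QuotientGroup.mk (s := Subgroup.zpowers q)) h
      rw [QuotientGroup.mk_mul_of_mem _ (Subgroup.npow_mem_zpowers q _),
        QuotientGroup.mk_mul_of_mem _ (Subgroup.npow_mem_zpowers q _)] at h1
      simpa using h1
    subst hc
    have h2 := mul_left_cancel h
    have h3 := pow_injOn_Iio_orderOf (Set.mem_Iio.2 i.2) (Set.mem_Iio.2 i'.2) h2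
    rw [Fin.ext h3]
  · intro r
    classical
    obtain ⟨h, hh⟩ := QuotientGroup.mk_out_eq_mul (Subgroup.zpowers q) r
    have h1 : (h : Q)⁻¹ ∈ Subgroup.zpowers q := inv_mem h.2
    rw [mem_zpowers_iff_mem_range_orderOf, Finset.mem_image] at h1
    obtain ⟨i, hi, hi2⟩ := h1
    refine ⟨(QuotientGroup.mk r, ⟨i, Finset.mem_range.1 hi⟩), ?_⟩
    simp only
    rw [hi2, hh, mul_inv_cancel_right]

lemma conj_equiv {Q : Type} [Group Q] [Finite Q] (q q' : Q) (h : orderOf q = orderOf q') :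
    ∃ e : Q ≃ Q, ∀ r (i : ℕ), e (r * q ^ i) = e r * q' ^ i := by
  let E1 := Equiv.ofBijective _ (coset_decomp q)
  let E2 := Equiv.ofBijective _ (coset_decomp q')
  have hpos : 0 < orderOf q := orderOf_pos q
  have hT : Nat.card (Q ⧸ Subgroup.zpowers q) = Nat.card (Q ⧸ Subgroup.zpowers q') := by
    have h1 := Nat.card_congr E1
    have h2 := Nat.card_congr E2
    rw [Nat.card_prod, Nat.card_fin] at h1 h2
    rw [← h2, ← h] at h1
    exact Nat.eq_of_mul_eq_mul_right hpos h1
  let τ : (Q ⧸ Subgroup.zpowers q) ≃ (Q ⧸ Subgroup.zpowers q') :=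
    (Finite.equivFinOfCardEq hT).trans (Finite.equivFinOfCardEq rfl).symm
  let e : Q ≃ Q := E1.symm.trans ((τ.prodCongr (finCongr h)).trans E2)
  have he : ∀ (t : Q ⧸ Subgroup.zpowers q) (j : ℕ), e (t.out * q ^ j) = (τ t).out * q' ^ j := by
    intro t j
    have h1 : t.out * q ^ j = E1 (t, ⟨j % orderOf q, Nat.mod_lt _ hpos⟩) := by
      simp only [E1, Equiv.ofBijective_apply]
      rw [pow_mod_orderOf]
    rw [h1]
    simp only [e, Equiv.trans_apply, Equiv.symm_apply_apply]
    simp only [E2, Equiv.ofBijective_apply, Equiv.prodCongr_apply, Prod.map, finCongr_apply,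
      Fin.val_cast]
    rw [h, pow_mod_orderOf]
  refine ⟨e, fun r i => ?_⟩
  obtain ⟨⟨t, j⟩, rfl⟩ := E1.surjective r
  simp only [E1, Equiv.ofBijective_apply]
  rw [mul_assoc, ← pow_add, he, he, pow_add, mul_assoc]

/-- The norm operator. -/
def NN {Q : Type} [Group Q] (n : ℕ) (q : Q) : (Q → ZMod 2) →+ (Q → ZMod 2) where
  toFun a r := ∑ i ∈ Finset.range n, a (r * q ^ i)
  map_zero' := by funext r; simp
  map_add' a b := by funext r; simp [Finset.sum_add_distrib]

lemma NN_apply {Q : Type} [Group Q] (n : ℕ) (q : Q) (a : Q → ZMod 2) (r : Q) :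
    NN n q a r = ∑ i ∈ Finset.range n, a (r * q ^ i) := rfl

lemma SD_pow {Q : Type} [Group Q] (n : ℕ) (q : Q) (a : Q → ZMod 2) :
    (⟨a, q⟩ : SD (regact Q)) ^ n = ⟨NN n q a, q ^ n⟩ := by
  induction n with
  | zero =>
    rw [pow_zero]
    apply SD.ext
    · funext r; simp [NN_apply]
    · simp
  | succ n ih =>
    rw [pow_succ, ih]
    apply SD.ext
    · funext r
      change NN n q a r + regact Q (q ^ n) a r = NN (n + 1) q a r
      rw [regact_apply, NN_apply, NN_apply, Finset.sum_range_succ]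
    · simp [pow_succ]

lemma SD_pow_eq_one {Q : Type} [Group Q] (n : ℕ) (q : Q) (a : Q → ZMod 2) :
    (⟨a, q⟩ : SD (regact Q)) ^ n = 1 ↔ q ^ n = 1 ∧ NN n q a = 0 := by
  rw [SD_pow, SD.ext_iff]
  exact and_comm

/-- Number of elements of the semidirect product over `q` of exponent `n`. -/
noncomputable def kN {Q : Type} [Group Q] (n : ℕ) (q : Q) : ℕ :=
  Nat.card {a : Q → ZMod 2 // (⟨a, q⟩ : SD (regact Q)) ^ n = 1}

lemma kN_congr {Q : Type} [Group Q] [Finite Q] (n : ℕ) (q q' : Q) (h : orderOf q = orderOf q') :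
    kN n q = kN n q' := by
  obtain ⟨e, he⟩ := conj_equiv q q' h
  apply Nat.card_congr
  refine Equiv.subtypeEquiv (Equiv.arrowCongr e (Equiv.refl _)) ?_
  intro a
  rw [SD_pow_eq_one, SD_pow_eq_one, ← orderOf_dvd_iff_pow_eq_one, ← orderOf_dvd_iff_pow_eq_one, h]
  apply and_congr_right
  intro _
  have key : ∀ r, NN n q' (Equiv.arrowCongr e (Equiv.refl _) a) (e r) = NN n q a r := by
    intro r
    rw [NN_apply, NN_apply]
    apply Finset.sum_congr rfl
    intro i _
    simp [← he]
  constructor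
  · intro h0
    funext r
    obtain ⟨r, rfl⟩ := e.surjective r
    rw [key, h0]; rfl
  · intro h0
    funext r
    rw [← key, h0]; rfl

/-- Elements in the kernel of the norm pair trivially with invariant functions. -/
lemma pair_zero {Q : Type} [Group Q] [Fintype Q] (q : Q) (φ b : Q → ZMod 2)
    (hφ : ∀ r, φ (r * q) = φ r) (hb : NN (orderOf q) q b = 0) : ∑ r, b r * φ r = 0 := by
  classical
  have := Fintype.ofFinite (Q ⧸ Subgroup.zpowers q)
  have hφ' : ∀ r (i : ℕ), φ (r * q ^ i) = φ r := by
    intro r i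
    induction i with
    | zero => simp
    | succ i ih => rw [pow_succ, ← mul_assoc, hφ, ih]
  rw [← Fintype.sum_equiv (Equiv.ofBijective _ (coset_decomp q)) _ (fun r => b r * φ r)
    (fun p => rfl), Fintype.sum_prod_type]
  apply Finset.sum_eq_zero
  intro t _
  simp only [Equiv.ofBijective_apply, hφ']
  rw [← Finset.sum_mul]
  have h1 := congrFun hb t.out
  rw [NN_apply, Finset.sum_range] at h1
  rw [h1]
  simp

end PW

namespace PW

/-- Combine a lift. -/
def comb {X Q : Type} [Group Q] (f : X → Q) (c : X → (Q → ZMod 2)) : X → SD (regact Q) :=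
  fun x => ⟨c x, f x⟩

lemma lift_comb_snd {X Q : Type} [Group Q] (f : X → Q) (c : X → (Q → ZMod 2)) (g : FreeGroup X) :
    (FreeGroup.lift (comb f c) g).snd = FreeGroup.lift f g := by
  have : (SD.proj (regact Q)).comp (FreeGroup.lift (comb f c)) = FreeGroup.lift f := by
    apply FreeGroup.ext_hom
    intro x
    simp [SD.proj, comb]
  exact DFunLike.congr_fun this g

lemma comb_crossed {X Q : Type} [Group Q] (f : X → Q) (c : X → (Q → ZMod 2)) :
    IsCrossed ((regact Q).comp (FreeGroup.lift f)) (fun g => (FreeGroup.lift (comb f c) g).fst) := by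
  intro g h
  beta_reduce
  rw [map_mul, SD.mul_fst, lift_comb_snd]
  rfl

/-- The map from choices of values on generators to the value of the crossed homomorphism. -/
def EE {X Q : Type} [Group Q] (f : X → Q) (w : FreeGroup X) :
    (X → (Q → ZMod 2)) →+ (Q → ZMod 2) where
  toFun c := (FreeGroup.lift (comb f c) w).fst
  map_zero' := by
    refine IsCrossed.eq (δ' := fun _ => 0) (comb_crossed f 0) ?_ ?_ w
    · intro g h; simp
    · intro x; simp [comb]
  map_add' c c' := by
    refine IsCrossed.eq (δ' := fun w => (FreeGroup.lift (comb f c) w).fst +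
      (FreeGroup.lift (comb f c') w).fst) (comb_crossed f _) ?_ ?_ w
    · intro g h
      have h1 := comb_crossed f c g h
      have h2 := comb_crossed f c' g h
      beta_reduce at h1 h2 ⊢
      rw [h1, h2, map_add]
      abel
    · intro x; simp [comb]

lemma lift_comb {X Q : Type} [Group Q] (f : X → Q) (c : X → (Q → ZMod 2)) (w : FreeGroup X) :
    FreeGroup.lift (comb f c) w = ⟨EE f w c, FreeGroup.lift f w⟩ :=
  SD.ext rfl (lift_comb_snd f c w)

lemma card_ker_mul_range {A B : Type} [AddCommGroup A] [AddCommGroup B] (f : A →+ B) :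
    Nat.card {a // f a = 0} * Nat.card f.range = Nat.card A := by
  have h1 := f.ker.card_eq_card_quotient_mul_card_addSubgroup
  have h2 := Nat.card_congr (QuotientAddGroup.quotientKerEquivRange f).toEquiv
  have h3 : Nat.card {a // f a = 0} = Nat.card f.ker := Nat.card_congr (Equiv.subtypeEquivRight
    (fun a => by rw [AddMonoidHom.mem_ker]))
  rw [h1, h2, h3, mul_comm]

/-- Kernel count comparison. -/
lemma ker_count {A : Type} [AddCommGroup A] [Finite A] {C : Type} [AddCommGroup C] [Finite C]
    (N : A →+ A) (E : C →+ A) (m : ℕ) (hC : Nat.card C = Nat.card A ^ m * Nat.card A) :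
    Nat.card A ^ m * Nat.card {a // N a = 0} ≤ Nat.card {c // N (E c) = 0} ∧
    (Nat.card A ^ m * Nat.card {a // N a = 0} = Nat.card {c // N (E c) = 0} →
      ∀ a, ∃ c, N (a - E c) = 0) := by
  have h1 := card_ker_mul_range N
  have h2 := card_ker_mul_range (N.comp E)
  simp only [AddMonoidHom.comp_apply] at h2
  have hle : (N.comp E).range ≤ N.range := by
    rintro _ ⟨c, rfl⟩
    exact ⟨E c, rfl⟩
  have hcard : Nat.card (N.comp E).range ≤ Nat.card N.range :=
    Nat.card_le_card_of_injective _ (AddSubgroup.inclusion_injective hle)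
  have hpos1 : 0 < Nat.card N.range := Nat.card_pos
  have hpos2 : 0 < Nat.card (N.comp E).range := Nat.card_pos
  have hpos3 : 0 < Nat.card {c // N (E c) = 0} := by
    have : Nonempty {c // N (E c) = 0} := ⟨⟨0, by simp⟩⟩
    exact Nat.card_pos
  have key : Nat.card A ^ m * Nat.card {a // N a = 0} * Nat.card N.range =
      Nat.card {c // N (E c) = 0} * Nat.card (N.comp E).range := by
    rw [h2, hC, mul_assoc, h1]
  constructor
  · by_contra hlt
    push Not at hlt
    have : Nat.card {c // N (E c) = 0} * Nat.card (N.comp E).range <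
        Nat.card A ^ m * Nat.card {a // N a = 0} * Nat.card N.range :=
      Nat.mul_lt_mul_of_lt_of_le hlt hcard hpos1
    omega
  · intro heq a
    rw [heq] at key
    have h5 := Nat.eq_of_mul_eq_mul_left hpos3 key
    have h6 : (N.comp E).range = N.range :=
      AddSubgroup.eq_of_le_of_card_ge hle h5.le
    have h7 : N a ∈ (N.comp E).range := by rw [h6]; exact ⟨a, rfl⟩
    obtain ⟨c, hc⟩ := h7
    refine ⟨c, ?_⟩
    rw [map_sub, ← hc]
    simp

theorem count_contra {X : Type} [Finite X] (m : ℕ) (hX : Nat.card X = m + 1) (w : FreeGroup X)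
    (H : ∀ (G : Type) [Group G] [Finite G] (d : ℕ), 0 < d →
      Nat.card {f : X → G // (FreeGroup.lift f w) ^ d = 1} =
        Nat.card G ^ m * Nat.card {q : G // q ^ d = 1}) : (1 : GA X) ∈ foxI w := by
  classical
  by_contra hnot
  obtain ⟨Q, _, _, ρ, φ, hφ1, hφw, hφδ⟩ := exists_Q w hnot
  have := Fintype.ofFinite X
  let f0 : X → Q := fun x => ρ (FreeGroup.of x)
  have hf0 : FreeGroup.lift f0 = ρ := by
    apply FreeGroup.ext_hom
    intro x
    simp [f0]
  set n := orderOf (ρ w) with hn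
  have hnpos : 0 < n := orderOf_pos _
  have hcA : Nat.card (X → (Q → ZMod 2)) = Nat.card (Q → ZMod 2) ^ m * Nat.card (Q → ZMod 2) := by
    rw [Nat.card_fun, hX, pow_succ]
  -- pointwise inequality
  let L : (X → Q) → ℕ := fun f =>
    Nat.card {c : X → (Q → ZMod 2) // (FreeGroup.lift (comb f c) w) ^ n = 1}
  let A := Nat.card (Q → ZMod 2)
  have hLeq : ∀ f, (FreeGroup.lift f w) ^ n = 1 →
      L f = Nat.card {c // NN n (FreeGroup.lift f w) (EE f w c) = 0} := by
    intro f hf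
    apply Nat.card_congr
    apply Equiv.subtypeEquivRight
    intro c
    rw [lift_comb, SD_pow_eq_one]
    simp [hf]
  have hkeq : ∀ q : Q, q ^ n = 1 → kN n q = Nat.card {a // NN n q a = 0} := by
    intro q hq
    apply Nat.card_congr
    apply Equiv.subtypeEquivRight
    intro c
    rw [SD_pow_eq_one]
    simp [hq]
  have hle : ∀ f, A ^ m * kN n (FreeGroup.lift f w) ≤ L f := by
    intro f
    by_cases hf : (FreeGroup.lift f w) ^ n = 1
    · rw [hLeq f hf, hkeq _ hf]
      exact (ker_count _ _ m hcA).1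
    · have : kN n (FreeGroup.lift f w) = 0 := by
        have : IsEmpty {a : Q → ZMod 2 // (⟨a, FreeGroup.lift f w⟩ : SD (regact Q)) ^ n = 1} :=
          ⟨fun a => hf ((SD_pow_eq_one _ _ _).1 a.2).1⟩
        exact Nat.card_of_isEmpty
      rw [this, mul_zero]
      exact Nat.zero_le _
  -- total counts
  have hsumL : ∑ f, L f = A ^ m * Nat.card Q ^ m * ∑ q : Q, kN n q := by
    have h1 := H (SD (regact Q)) n hnpos
    have h2 : Nat.card {f : X → SD (regact Q) // (FreeGroup.lift f w) ^ n = 1} = ∑ f, L f := by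
      rw [← Nat.card_sigma]
      apply Nat.card_congr
      exact
        { toFun := fun p => ⟨fun x => (p.1 x).snd, fun x => (p.1 x).fst, p.2⟩
          invFun := fun p => ⟨comb p.1 p.2.1, p.2.2⟩
          left_inv := fun p => rfl
          right_inv := fun p => rfl }
    have h3 : Nat.card {z : SD (regact Q) // z ^ n = 1} = ∑ q : Q, kN n q := by
      unfold kN
      rw [← Nat.card_sigma]
      apply Nat.card_congr
      exact
        { toFun := fun p => ⟨p.1.snd, p.1.fst, p.2⟩
          invFun := fun p => ⟨⟨p.2.1, p.1⟩, p.2.2⟩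
          left_inv := fun p => rfl
          right_inv := fun p => rfl }
    have h4 : Nat.card (SD (regact Q)) = A * Nat.card Q := by
      rw [← Nat.card_prod]
      apply Nat.card_congr
      exact
        { toFun := fun p => (p.fst, p.snd)
          invFun := fun p => ⟨p.1, p.2⟩
          left_inv := fun p => rfl
          right_inv := fun p => rfl }
    rw [← h2, h1, h3, h4, mul_pow]
  have hsumk : ∑ f : X → Q, kN n (FreeGroup.lift f w) = Nat.card Q ^ m * ∑ q : Q, kN n q := by
    obtain ⟨g, hg⟩ : ∃ g : ℕ → ℕ, ∀ q : Q, kN n q = g (orderOf q) := by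
      have : Function.FactorsThrough (kN n : Q → ℕ) orderOf := fun q q' h => kN_congr n q q' h
      obtain ⟨g, hg⟩ := (Function.factorsThrough_iff _).1 this
      exact ⟨g, fun q => congrFun hg q⟩
    simp only [hg]
    apply fiber_sum (fun f : X → Q => orderOf (FreeGroup.lift f w)) (fun q : Q => orderOf q)
      (fun _ => orderOf_pos _) (fun _ => orderOf_pos _)
    intro d hd
    have h1 := H Q d hd
    simp only [orderOf_dvd_iff_pow_eq_one]
    rw [← Fintype.card_subtype, ← Fintype.card_subtype, ← Nat.card_eq_fintype_card,
      ← Nat.card_eq_fintype_card]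
    exact h1
  have heq : ∑ f : X → Q, A ^ m * kN n (FreeGroup.lift f w) = ∑ f, L f := by
    rw [← Finset.mul_sum, hsumk, hsumL, mul_assoc]
  have hpt := (Finset.sum_eq_sum_iff_of_le (fun f _ => hle f)).1 heq f0 (Finset.mem_univ _)
  have hq1 : (FreeGroup.lift f0 w) ^ n = 1 := by rw [hf0, hn, pow_orderOf_eq_one]
  rw [hLeq f0 hq1, hkeq _ hq1] at hpt
  obtain ⟨c, hc⟩ := (ker_count _ _ m hcA).2 hpt (Pi.single 1 1)
  rw [hf0, hn] at hc
  have h1 := pair_zero (ρ w) φ _ hφw hc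
  have h2 := hφδ (fun g => (FreeGroup.lift (comb f0 c) g).fst) (by
    have := comb_crossed f0 c
    rwa [hf0] at this)
  have h3 : ∑ r, (Pi.single 1 1 : Q → ZMod 2) r * φ r = φ 1 := by
    rw [Finset.sum_eq_single 1]
    · simp
    · intro b _ hb; simp [Pi.single_eq_of_ne hb]
    · simp
  simp only [Pi.sub_apply, sub_mul, Finset.sum_sub_distrib] at h1
  rw [h3] at h1
  apply hφ1
  have h4 : ∑ r, EE f0 w c r * φ r = 0 := h2
  rw [h4, sub_zero] at h1
  exact h1

end PW

namespace PW

/-- Homs from one group inject into homs from the other, if finite quotients transfer. -/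
lemma card_hom_le {G K : Type} [Group G] [Group K] (Q : Type) [Group Q] [Finite Q]
    [Finite (G →* Q)] [Finite (K →* Q)]
    (h : ∀ (P : Type) (_ : Group P) (_ : Finite P), (∃ f : G →* P, Function.Surjective f) →
      ∃ f : K →* P, Function.Surjective f) :
    Nat.card (G →* Q) ≤ Nat.card (K →* Q) := by
  let ev : G →* ((G →* Q) → Q) := Pi.monoidHom (fun f => f)
  obtain ⟨s, hs⟩ := h ev.range inferInstance inferInstance ⟨ev.rangeRestrict,
    ev.rangeRestrict_surjective⟩
  apply Nat.card_le_card_of_injective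
    (fun f : G →* Q => ((Pi.evalMonoidHom (fun _ : G →* Q => Q) f).comp ev.range.subtype).comp s)
  intro f f' hff
  apply MonoidHom.ext
  intro g
  obtain ⟨k, hk⟩ := hs (ev.rangeRestrict g)
  have h1 := DFunLike.congr_fun hff k
  simp only [MonoidHom.comp_apply, hk] at h1
  exact h1

/-- Homomorphisms out of a cyclic group. -/
def zhom {Q : Type} [Group Q] (n : ℕ) (q : Q) (hq : q ^ n = 1) : Multiplicative (ZMod n) →* Q where
  toFun z := (ZMod.lift n ⟨zmultiplesHom (Additive Q) (Additive.ofMul q), by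
    simp [← ofMul_pow, hq]⟩ z.toAdd).toMul
  map_one' := by simp
  map_mul' a b := by simp

lemma zhom_apply {Q : Type} [Group Q] (n : ℕ) (q : Q) (hq : q ^ n = 1) :
    zhom n q hq (Multiplicative.ofAdd 1) = q := by
  have h := ZMod.lift_coe n (A := Additive Q) ⟨zmultiplesHom (Additive Q) (Additive.ofMul q), by
    simp [← ofMul_pow, hq]⟩ 1
  rw [Int.cast_one] at h
  change Additive.toMul (ZMod.lift n _ (1 : ZMod n)) = q
  rw [h]
  simp

lemma ofAdd_zmod {n : ℕ} (z : Multiplicative (ZMod n)) :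
    ∃ j : ℤ, z = (Multiplicative.ofAdd (1 : ZMod n)) ^ j := by
  obtain ⟨j, hj⟩ := ZMod.intCast_surjective z.toAdd
  refine ⟨j, ?_⟩
  rw [← ofAdd_zsmul, zsmul_one, hj]
  rfl

lemma ofAdd_pow_n (n : ℕ) : (Multiplicative.ofAdd (1 : ZMod n)) ^ n = 1 := by
  rw [← ofAdd_nsmul]
  simp

/-- Homs out of a cyclic group are elements of exponent `n`. -/
def zEquiv (Q : Type) [Group Q] (n : ℕ) : (Multiplicative (ZMod n) →* Q) ≃ {q : Q // q ^ n = 1} where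
  toFun f := ⟨f (Multiplicative.ofAdd 1), by rw [← map_pow, ofAdd_pow_n, map_one]⟩
  invFun q := zhom n q.1 q.2
  left_inv f := by
    apply MonoidHom.ext
    intro z
    obtain ⟨j, rfl⟩ := ofAdd_zmod z
    rw [map_zpow, map_zpow, zhom_apply]
  right_inv q := Subtype.ext (zhom_apply n q.1 q.2)

/-- Homs out of the free product. -/
def kEquiv (Q : Type) [Group Q] (n m : ℕ) :
    (Monoid.Coprod (FreeGroup (Fin m)) (Multiplicative (ZMod n)) →* Q) ≃
      (Fin m → Q) × {q : Q // q ^ n = 1} :=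
  Monoid.Coprod.liftEquiv.symm.trans (FreeGroup.lift.symm.prodCongr (zEquiv Q n))

/-- Homs out of the one-relator group. -/
def gEquiv (X Q : Type) [Group Q] (n : ℕ) (w : FreeGroup X) :
    (PresentedGroup ({w ^ n} : Set (FreeGroup X)) →* Q) ≃
      {f : X → Q // (FreeGroup.lift f w) ^ n = 1} where
  toFun f := ⟨fun x => f (PresentedGroup.of x), by
    have h1 : FreeGroup.lift (fun x => f (PresentedGroup.of x)) = f.comp (PresentedGroup.mk _) := by
      apply FreeGroup.ext_hom
      intro x
      simp [PresentedGroup.of]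
    rw [h1, ← map_pow, MonoidHom.comp_apply]
    rw [PresentedGroup.one_of_mem (Set.mem_singleton _), map_one]⟩
  invFun f := PresentedGroup.toGroup (f := f.1) (by
    intro r hr
    rw [Set.mem_singleton_iff] at hr
    rw [hr, map_pow, f.2])
  left_inv f := by
    apply PresentedGroup.ext
    intro x
    simp
  right_inv f := by
    apply Subtype.ext
    funext x
    simp

theorem count_of_same {m : ℕ} (w : FreeGroup (Fin (m + 1))) (N : ℕ)
    (h : ∀ n : ℕ, N ≤ n → ∀ (Q : Type) (_ : Group Q) (_ : Finite Q),
        (∃ f : PresentedGroup ({w ^ n} : Set (FreeGroup (Fin (m + 1)))) →* Q,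
            Function.Surjective f) ↔
        (∃ f : Monoid.Coprod (FreeGroup (Fin m)) (Multiplicative (ZMod n)) →* Q,
            Function.Surjective f))
    (Q : Type) [Group Q] [Finite Q] (d : ℕ) :
    Nat.card {f : Fin (m + 1) → Q // (FreeGroup.lift f w) ^ d = 1} =
        Nat.card Q ^ m * Nat.card {q : Q // q ^ d = 1} := by
  set n := d + Nat.card Q * N with hn
  have hNn : N ≤ n := by
    have : 0 < Nat.card Q := Nat.card_pos
    nlinarith
  have hpow : ∀ x : Q, x ^ n = x ^ d := by
    intro x
    rw [hn, pow_add, pow_mul, pow_card_eq_one', one_pow, mul_one]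
  have f1 : Finite (PresentedGroup ({w ^ n} : Set (FreeGroup (Fin (m + 1)))) →* Q) :=
    Finite.of_equiv _ (gEquiv (Fin (m + 1)) Q n w).symm
  have f2 : Finite (Monoid.Coprod (FreeGroup (Fin m)) (Multiplicative (ZMod n)) →* Q) :=
    Finite.of_equiv _ (kEquiv Q n m).symm
  have h1 := le_antisymm (card_hom_le Q (fun P _ _ => (h n hNn P _ ‹_›).1))
    (card_hom_le Q (fun P _ _ => (h n hNn P _ ‹_›).2))
  rw [Nat.card_congr (gEquiv (Fin (m + 1)) Q n w), Nat.card_congr (kEquiv Q n m), Nat.card_prod,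
    Nat.card_fun, Nat.card_fin] at h1
  simpa only [hpow] using h1

theorem easy_dir {m : ℕ} (φ : FreeGroup (Fin (m + 1)) ≃* FreeGroup (Fin (m + 1)))
    (w : FreeGroup (Fin (m + 1))) (hw : φ (FreeGroup.of 0) = w) (n : ℕ) (Q : Type) [Group Q] :
    (∃ f : PresentedGroup ({w ^ n} : Set (FreeGroup (Fin (m + 1)))) →* Q,
            Function.Surjective f) ↔
        (∃ f : Monoid.Coprod (FreeGroup (Fin m)) (Multiplicative (ZMod n)) →* Q,
            Function.Surjective f) := by
  constructor
  · rintro ⟨f, hf⟩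
    let g : FreeGroup (Fin (m + 1)) →* Q := (f.comp (PresentedGroup.mk _)).comp φ.toMonoidHom
    have hg : Function.Surjective g :=
      (hf.comp (PresentedGroup.mk_surjective _)).comp φ.surjective
    have hg0 : g (FreeGroup.of 0) ^ n = 1 := by
      have : g (FreeGroup.of 0) = f (PresentedGroup.mk _ w) := by
        simp [g, hw]
      rw [this, ← map_pow, ← map_pow, PresentedGroup.one_of_mem (Set.mem_singleton _), map_one]
    let F : Monoid.Coprod (FreeGroup (Fin m)) (Multiplicative (ZMod n)) →* Q :=
      Monoid.Coprod.lift (FreeGroup.lift (fun i => g (FreeGroup.of i.succ))) (zhom n _ hg0)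
    refine ⟨F, ?_⟩
    have key : ∀ a, g a ∈ F.range := by
      intro a
      induction a using FreeGroup.induction_on with
      | C1 => rw [map_one]; exact one_mem _
      | of x =>
        refine Fin.cases ?_ (fun i => ?_) x
        · exact ⟨Monoid.Coprod.inr (Multiplicative.ofAdd 1), by simp [F, zhom_apply]⟩
        · exact ⟨Monoid.Coprod.inl (FreeGroup.of i), by simp [F]⟩
      | inv_of x hx => rw [map_inv]; exact inv_mem hx
      | mul a b ha hb => rw [map_mul]; exact mul_mem ha hb
    intro q
    obtain ⟨a, rfl⟩ := hg q
    exact key a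
  · rintro ⟨f, hf⟩
    let g : FreeGroup (Fin (m + 1)) →* Q := FreeGroup.lift
      (Fin.cons (f (Monoid.Coprod.inr (Multiplicative.ofAdd 1)))
        (fun i => f (Monoid.Coprod.inl (FreeGroup.of i))))
    let g' : FreeGroup (Fin (m + 1)) →* Q := g.comp φ.symm.toMonoidHom
    have hlift : FreeGroup.lift (fun x => g' (FreeGroup.of x)) = g' := by
      apply FreeGroup.ext_hom
      intro x
      simp
    have hgw : g' w ^ n = 1 := by
      have : g' w = f (Monoid.Coprod.inr (Multiplicative.ofAdd 1)) := by
        simp [g', g, ← hw]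
      rw [this, ← map_pow, ← map_pow, ofAdd_pow_n, map_one, map_one]
    let F := (gEquiv (Fin (m + 1)) Q n w).symm ⟨fun x => g' (FreeGroup.of x), by rw [hlift, hgw]⟩
    have hF : ∀ a, F (PresentedGroup.mk _ a) = g' a := by
      intro a
      have : F.comp (PresentedGroup.mk _) = g' := by
        apply FreeGroup.ext_hom
        intro x
        have h3 := congrArg Subtype.val ((gEquiv (Fin (m + 1)) Q n w).apply_symm_apply
          ⟨fun x => g' (FreeGroup.of x), by rw [hlift, hgw]⟩)
        exact congrFun h3 x
      exact DFunLike.congr_fun this a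
    have hF2 : ∀ a, F (PresentedGroup.mk _ (φ a)) = g a := by
      intro a
      rw [hF]
      simp [g']
    refine ⟨F, ?_⟩
    have hr : f.range ≤ F.range := by
      rw [Monoid.Coprod.range_eq]
      apply sup_le
      · rintro _ ⟨a, rfl⟩
        induction a using FreeGroup.induction_on with
        | C1 => rw [map_one]; exact one_mem _
        | of x =>
          exact ⟨PresentedGroup.mk _ (φ (FreeGroup.of x.succ)), by rw [hF2]; simp [g]⟩
        | inv_of x hx => rw [map_inv]; exact inv_mem hx
        | mul a b ha hb => rw [map_mul]; exact mul_mem ha hb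
      · rintro _ ⟨z, rfl⟩
        obtain ⟨j, rfl⟩ := ofAdd_zmod z
        rw [map_zpow]
        apply zpow_mem
        exact ⟨PresentedGroup.mk _ (φ (FreeGroup.of 0)), by rw [hF2]; simp [g]⟩
    intro q
    obtain ⟨a, rfl⟩ := hf q
    exact hr ⟨a, rfl⟩

end PW

theorem primitive_iff_same_finite_quotients (k : ℕ) (hk : 2 ≤ k) (w : FreeGroup (Fin k)) :
    (∃ φ : FreeGroup (Fin k) ≃* FreeGroup (Fin k),
        φ (FreeGroup.of (⟨0, by omega⟩ : Fin k)) = w) ↔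
    (∃ N : ℕ, 0 < N ∧ ∀ n : ℕ, N ≤ n →
      ∀ (Q : Type) (_ : Group Q) (_ : Finite Q),
        (∃ f : PresentedGroup ({w ^ n} : Set (FreeGroup (Fin k))) →* Q,
            Function.Surjective f) ↔
        (∃ f : Monoid.Coprod (FreeGroup (Fin (k - 1))) (Multiplicative (ZMod n)) →* Q,
            Function.Surjective f)) := by
  obtain ⟨m, rfl⟩ : ∃ m, k = m + 1 := ⟨k - 1, by omega⟩
  constructor
  · rintro ⟨φ, hφ⟩
    exact ⟨1, one_pos, fun n _ Q _ _ => PW.easy_dir φ w hφ n Q⟩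
  · rintro ⟨N, _, h⟩
    have h1 := PW.count_contra m (by simp) w
      (fun G _ _ d _ => PW.count_of_same w N h G d)
    obtain ⟨e, x, hex⟩ := PW.primitive_of_one_mem w h1
    refine ⟨(FreeGroup.freeGroupCongr (Equiv.swap 0 x)).trans e, ?_⟩
    rw [← hex]
    change e (FreeGroup.freeGroupCongr (Equiv.swap 0 x) (FreeGroup.of 0)) = _
    simp
end

section
/- The element w = b a b⁻¹ a⁻² of the free group F_2 on generators a, b is not primitive: there is no automorphism of F_2 sending the basis element a to b a b⁻¹ a⁻² (equivalently, b a b⁻¹ a⁻² does not belong to any free basis of F_2). -/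
/-- A homomorphism from the free group on two generators that kills the first generator
has image inside the cyclic group generated by the image of the second one. -/
theorem mem_zpowers_of_kills {G : Type*} [Group G] (g : FreeGroup (Fin 2) →* G)
    (h : g (FreeGroup.of 0) = 1) (x : FreeGroup (Fin 2)) :
    g x ∈ Subgroup.zpowers (g (FreeGroup.of 1)) := by
  have key : ∀ i : Fin 2, g (FreeGroup.of i) ∈ Subgroup.zpowers (g (FreeGroup.of 1)) := by
    intro i
    fin_cases i
    · simp only [Fin.zero_eta]
      rw [h]
      exact one_mem _
    · exact Subgroup.mem_zpowers _
  induction x using FreeGroup.induction_on with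
  | C1 => rw [map_one]; exact one_mem _
  | of i => exact key i
  | inv_of i _ => rw [map_inv]; exact inv_mem (key i)
  | mul x y hx hy => rw [map_mul]; exact mul_mem hx hy

/-- the word `w = b a b⁻¹ a⁻²` is not a primitive element of the free
group on two generators `a = of 0`, `b = of 1`. -/
theorem not_primitive_bab_inv_a_sq :
    ¬ ∃ φ : FreeGroup (Fin 2) ≃* FreeGroup (Fin 2),
      φ (FreeGroup.of 0) =
        FreeGroup.of 1 * FreeGroup.of 0 * (FreeGroup.of 1)⁻¹ * (FreeGroup.of 0)⁻¹ ^ 2 := by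
  rintro ⟨φ, hφ⟩
  let s : Equiv.Perm (Fin 3) := Equiv.swap 0 1 * Equiv.swap 1 2
  let t : Equiv.Perm (Fin 3) := Equiv.swap 0 1
  let f : FreeGroup (Fin 2) →* Equiv.Perm (Fin 3) := FreeGroup.lift ![s, t]
  have f0 : f (FreeGroup.of 0) = s := by simp [f]
  have f1 : f (FreeGroup.of 1) = t := by simp [f]
  have hk : (f.comp φ.toMonoidHom) (FreeGroup.of 0) = 1 := by
    change f (φ (FreeGroup.of 0)) = 1
    rw [hφ]
    simp only [map_mul, map_inv, map_pow, f0, f1]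
    decide
  have hs := mem_zpowers_of_kills _ hk (φ.symm (FreeGroup.of 0))
  have ht := mem_zpowers_of_kills _ hk (φ.symm (FreeGroup.of 1))
  simp only [MonoidHom.comp_apply, MulEquiv.toMonoidHom_eq_coe, MonoidHom.coe_coe,
    MulEquiv.apply_symm_apply, f0, f1] at hs ht
  obtain ⟨m, hm⟩ := hs
  obtain ⟨n, hn⟩ := ht
  have hc : s * t = t * s := by
    rw [← hm, ← hn]
    exact zpow_mul_comm _ m n
  revert hc
  decide
end
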